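/- arXiv:1511.07253 — 6 statements merged into one kernel-verified Lean document; each statement's English description precedes it below -/
import Mathlib

section
/- In PG(5,q), with q a prime power, let S be a hyperplane and X a point of S. Let L be a set of lines of PG(5,q), none of them contained in S, none of them passing through X, such that no two lines of L meet in a point outside S, and such that |L| < q^3. Then there exists a line of PG(5,q) through X, not contained in S, which is skew to every line of L. -/
open Module

/-- A subspace of dimension `k + 1` not contained in a hyperplane `S` has
`q ^ (k + 1) - q ^ k` vectors outside `S`. -/
theorem Submodule.ncard_diff_hyperplane_add {F V : Type*} [Field F] [Fintype F] [AddCommGroup V]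
    [Module F V] [FiniteDimensional F V] {S W : Submodule F V} {k : ℕ}
    (hS : finrank F S + 1 = finrank F V) (hWS : ¬ W ≤ S) (hW : finrank F W = k + 1) :
    ((W : Set V) \ S).ncard + Fintype.card F ^ k = Fintype.card F ^ (k + 1) := by
  have : Finite V := Module.finite_of_finite F
  have hcard (U : Submodule F V) : (U : Set V).ncard = Fintype.card F ^ finrank F U := by
    rw [← Nat.card_eq_fintype_card, ← Module.natCard_eq_pow_finrank (K := F) (V := U)]
    rfl
  have hlt : S < W ⊔ S := by simpa using hWS
  have hlt' := Submodule.finrank_lt_finrank_of_lt hlt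
  have hle := Submodule.finrank_le (W ⊔ S)
  have hadd := Submodule.finrank_sup_add_finrank_inf_eq W S
  have hinf : finrank F ↥(W ⊓ S) = k := by omega
  have h := Set.ncard_sdiff_add_ncard_of_subset
    (Set.inter_subset_left : (W : Set V) ∩ S ⊆ W) (Set.toFinite _)
  rwa [Set.sdiff_self_inter, ← Submodule.coe_inf, hcard, hcard, hinf, hW] at h

/-- If `v` lies outside `X ⊔ l` and `X` is disjoint from `l`, then `X ⊔ span {v}` is disjoint
from `l`. -/
theorem Submodule.disjoint_sup_span_singleton {F V : Type*} [Field F] [AddCommGroup V]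
    [Module F V] {X l : Submodule F V} {v : V} (hXl : Disjoint X l) (hv : v ∉ X ⊔ l) :
    Disjoint (X ⊔ F ∙ v) l := by
  have hv0 : v ≠ 0 := fun h => hv (h ▸ zero_mem _)
  have hd : Disjoint (X ⊔ l) (F ∙ v) := (Submodule.disjoint_span_singleton' hv0).2 hv
  rw [sup_comm]
  exact hXl.disjoint_sup_left_of_disjoint_sup_right hd.symm

/-- In PG(5,q), q a prime power, let `S` be a hyperplane and `X` a point of `S`.
Let `L` be a set of lines, none contained in `S`, none through `X`, no two of
them meeting in a point outside `S`, with `|L| < q^3`. Then there is a line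
through `X`, not contained in `S`, skew to every line of `L`. -/
theorem stmt0 (F : Type*) [Field F] [Fintype F] (q : ℕ) (hq : Fintype.card F = q)
    (S : Submodule F (Fin 6 → F)) (hS : Module.finrank F ↥S = 5)
    (X : Submodule F (Fin 6 → F)) (hX : Module.finrank F ↥X = 1) (hXS : X ≤ S)
    (L : Set (Submodule F (Fin 6 → F)))
    (hLlines : ∀ l ∈ L, Module.finrank F ↥l = 2)
    (hLnotS : ∀ l ∈ L, ¬ l ≤ S)
    (hLnotX : ∀ l ∈ L, ¬ X ≤ l)
    (hLmeet : ∀ l ∈ L, ∀ l' ∈ L, l ≠ l' →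
      ∀ P : Submodule F (Fin 6 → F), Module.finrank F ↥P = 1 → P ≤ l → P ≤ l' → P ≤ S)
    (hLcard : L.ncard < q ^ 3) :
    ∃ m : Submodule F (Fin 6 → F), Module.finrank F ↥m = 2 ∧ X ≤ m ∧ ¬ m ≤ S ∧
      ∀ l ∈ L, m ⊓ l = ⊥ := by
  subst hq
  have hV : finrank F (Fin 6 → F) = 6 := by simp
  have hdisj : ∀ l ∈ L, Disjoint X l := fun l hl =>
    ((Submodule.isAtom_iff_finrank_eq_one.2 hX).not_le_iff_disjoint).1 (hLnotX l hl)
  have hSV : finrank F S + 1 = finrank F (Fin 6 → F) := by omega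
  have htop := Submodule.ncard_diff_hyperplane_add (W := ⊤) (k := 5) hSV
    (fun h => by have := Submodule.finrank_mono h; simp at this; omega) (by simp)
  have hsup : ∀ l ∈ L, (((X ⊔ l : Submodule F (Fin 6 → F)) : Set (Fin 6 → F)) \ S).ncard
      + Fintype.card F ^ 2 = Fintype.card F ^ 3 := fun l hl => by
    refine Submodule.ncard_diff_hyperplane_add hSV
      (fun h => hLnotS l hl (le_sup_right.trans h)) ?_
    have := Submodule.finrank_sup_add_finrank_inf_eq X l
    rw [(hdisj l hl).eq_bot, finrank_bot, hX, hLlines l hl] at this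
    omega
  obtain ⟨v, hvS, hv⟩ : ∃ v, v ∉ S ∧ ∀ l ∈ L, v ∉ X ⊔ l := by
    by_contra! hcon
    have hLfin : L.Finite := Set.toFinite L
    have hsub : ((⊤ : Submodule F (Fin 6 → F)) : Set (Fin 6 → F)) \ S ⊆
        ⋃ l ∈ hLfin.toFinset, ((X ⊔ l : Submodule F (Fin 6 → F)) : Set (Fin 6 → F)) \ S := by
      rintro v ⟨-, hvS⟩
      obtain ⟨l, hl, hvl⟩ := hcon v hvS
      simp only [Set.mem_iUnion]
      exact ⟨l, hLfin.mem_toFinset.2 hl, hvl, hvS⟩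
    have hle := (Set.ncard_le_ncard hsub (Set.toFinite _)).trans
      (Finset.set_ncard_biUnion_le _ _)
    have hq : 1 < Fintype.card F := Fintype.one_lt_card
    have hsum : ∑ l ∈ hLfin.toFinset,
        (((X ⊔ l : Submodule F (Fin 6 → F)) : Set (Fin 6 → F)) \ S).ncard =
        L.ncard * (Fintype.card F ^ 3 - Fintype.card F ^ 2) := by
      rw [Finset.sum_const_nat (m := Fintype.card F ^ 3 - Fintype.card F ^ 2),
        Set.ncard_eq_toFinset_card L hLfin]
      intro l hl
      have := hsup l (hLfin.mem_toFinset.1 hl)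
      omega
    rw [hsum] at hle
    have hpos : 0 < Fintype.card F ^ 3 - Fintype.card F ^ 2 :=
      Nat.sub_pos_of_lt (Nat.pow_lt_pow_right hq (by norm_num))
    have hlt := hle.trans_lt (Nat.mul_lt_mul_of_pos_right hLcard hpos)
    rw [Nat.mul_sub, ← pow_add, ← pow_add] at hlt
    norm_num at hlt htop
    omega
  have hvX : v ∉ X := fun h => hvS (hXS h)
  have hv0 : v ≠ 0 := fun h => hvS (h ▸ S.zero_mem)
  refine ⟨X ⊔ F ∙ v, ?_, le_sup_left, fun h => hvS (h ?_), fun l hl =>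
    (Submodule.disjoint_sup_span_singleton (hdisj l hl) (hv l hl)).eq_bot⟩
  · have := Submodule.finrank_sup_add_finrank_inf_eq X (F ∙ v)
    rw [((Submodule.disjoint_span_singleton' hv0).2 hvX).eq_bot, finrank_bot, hX,
      finrank_span_singleton hv0] at this
    omega
  · exact Submodule.mem_sup_right (Submodule.mem_span_singleton_self v)
end

section
/- In PG(5,q), q a prime power, for every integer k with 1 ≤ k ≤ ⌊(q^3 − q^2)/(q+1)⌋ there exists a maximal partial line spread of size q^3 + q^2 + kq + 1. -/
/-- A partial line spread of PG(n-1, q): a set of lines (2-dimensional linear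
subspaces of `F^n`) that are pairwise skew, i.e. pairwise intersecting only
in the zero subspace. -/
def IsPartialLineSpread (F : Type*) [Field F] (n : ℕ)
    (S : Set (Submodule F (Fin n → F))) : Prop :=
  (∀ l ∈ S, Module.finrank F ↥l = 2) ∧
  (∀ l ∈ S, ∀ l' ∈ S, l ≠ l' → l ⊓ l' = ⊥)

/-- A maximal partial line spread: a partial line spread such that every line
of the space meets some line of the spread nontrivially (equivalently, it
cannot be extended to a larger partial line spread). -/
def IsMaximalPartialLineSpread (F : Type*) [Field F] (n : ℕ)
    (S : Set (Submodule F (Fin n → F))) : Prop :=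
  IsPartialLineSpread F n S ∧
  ∀ m : Submodule F (Fin n → F), Module.finrank F ↥m = 2 → ∃ l ∈ S, m ⊓ l ≠ ⊥

open Module

/-- The subspaces of a pairwise disjoint family `T` of `d`-dimensional subspaces cover
`|T| * (q ^ d - 1)` nonzero vectors. -/
lemma ncard_nonzero_mem_of_pairwise_disjoint {F W : Type*} [Field F] [AddCommGroup W]
    [Module F W] [Finite W] {d : ℕ} {T : Set (Submodule F W)}
    (hd : ∀ l ∈ T, finrank F l = d) (hT : T.Pairwise Disjoint) :
    {v : W | v ≠ 0 ∧ ∃ l ∈ T, v ∈ l}.ncard = T.ncard * (Nat.card F ^ d - 1) := by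
  induction T, T.toFinite using Set.Finite.induction_on with
  | empty => simp
  | @insert a s ha hs ih =>
    have hsplit : {v : W | v ≠ 0 ∧ ∃ l ∈ insert a s, v ∈ l} =
        ((a : Set W) \ {0}) ∪ {v : W | v ≠ 0 ∧ ∃ l ∈ s, v ∈ l} := by
      ext v
      simp only [Set.mem_ofPred_eq, Set.exists_mem_insert, Set.mem_union, Set.mem_sdiff,
        SetLike.mem_coe, Set.mem_singleton_iff]
      tauto
    have hdisj : Disjoint ((a : Set W) \ {0}) {v : W | v ≠ 0 ∧ ∃ l ∈ s, v ∈ l} := by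
      rw [Set.disjoint_left]
      rintro v ⟨hva, hv0⟩ ⟨-, l, hl, hvl⟩
      have hal : Disjoint a l := hT (Set.mem_insert a s) (Set.mem_insert_of_mem a hl)
        (fun h => ha (h ▸ hl))
      exact hv0 (Submodule.disjoint_def.1 hal v hva hvl)
    have hcard : ((a : Set W) \ {0}).ncard = Nat.card F ^ d - 1 := by
      rw [Set.ncard_sdiff_singleton_of_mem (by simp), ← hd a (Set.mem_insert a s),
        ← Module.natCard_eq_pow_finrank]
      rfl
    rw [hsplit, Set.ncard_union_eq hdisj, hcard, Set.ncard_insert_of_notMem ha,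
      ih (fun l hl => hd l (Set.mem_insert_of_mem a hl)) (hT.mono (Set.subset_insert a s))]
    ring

/-- The points (one-dimensional subspaces) lying on no member of `T`. -/
def holes {F W : Type*} [Field F] [AddCommGroup W] [Module F W] (T : Set (Submodule F W)) :
    Set (Submodule F W) :=
  {p | finrank F p = 1 ∧ ∀ l ∈ T, Disjoint p l}

lemma pairwise_disjoint_holes {F W : Type*} [Field F] [AddCommGroup W] [Module F W]
    (T : Set (Submodule F W)) : (holes T).Pairwise Disjoint := fun _ hp _ hp' h =>
  (Submodule.isAtom_iff_finrank_eq_one.2 hp.1).disjoint_of_ne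
    (Submodule.isAtom_iff_finrank_eq_one.2 hp'.1) h

lemma span_singleton_mem_holes {F W : Type*} [Field F] [AddCommGroup W] [Module F W]
    {T : Set (Submodule F W)} {v : W} (hv : v ≠ 0) (hvT : ∀ l ∈ T, v ∉ l) :
    Submodule.span F {v} ∈ holes T := by
  refine ⟨finrank_span_singleton hv, fun l hl => ?_⟩
  rw [← (Submodule.isAtom_iff_finrank_eq_one.2 (finrank_span_singleton hv)).not_le_iff_disjoint]
  simpa using hvT l hl

/-- A partial line spread of the 4-dimensional projective space that falls `k` lines short of
`q ^ 3 + 1` has `q ^ 2 + k * (q + 1)` holes. -/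
lemma ncard_holes {F W : Type*} [Field F] [Finite F] [AddCommGroup W] [Module F W] [Finite W]
    (hW : finrank F W = 5) {T : Set (Submodule F W)} (hT2 : ∀ l ∈ T, finrank F l = 2)
    (hT : T.Pairwise Disjoint) {k : ℕ} (hTk : T.ncard + k = Nat.card F ^ 3 + 1) :
    (holes T).ncard = Nat.card F ^ 2 + k * (Nat.card F + 1) := by
  have hlines := ncard_nonzero_mem_of_pairwise_disjoint hT2 hT
  have hpoints := ncard_nonzero_mem_of_pairwise_disjoint (fun p hp => hp.1)
    (pairwise_disjoint_holes T)
  have hunion : {v : W | v ≠ 0 ∧ ∃ l ∈ T, v ∈ l} ∪ {v : W | v ≠ 0 ∧ ∃ l ∈ holes T, v ∈ l} =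
      {0}ᶜ := by
    ext v
    simp only [Set.mem_ofPred_eq, Set.mem_union, Set.mem_compl_iff, Set.mem_singleton_iff]
    refine ⟨by tauto, fun hv => ?_⟩
    by_cases h : ∃ l ∈ T, v ∈ l
    · exact Or.inl ⟨hv, h⟩
    · push Not at h
      exact Or.inr ⟨hv, _, span_singleton_mem_holes hv h, Submodule.mem_span_singleton_self v⟩
  have hdisj : Disjoint {v : W | v ≠ 0 ∧ ∃ l ∈ T, v ∈ l}
      {v : W | v ≠ 0 ∧ ∃ l ∈ holes T, v ∈ l} := by
    rw [Set.disjoint_left]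
    rintro v ⟨hv, l, hl, hvl⟩ ⟨-, p, hp, hvp⟩
    exact hv (Submodule.disjoint_def.1 (hp.2 l hl) v hvp hvl)
  have htotal := Set.ncard_union_eq hdisj
  have hcompl := Set.ncard_add_ncard_compl ({0} : Set W)
  rw [Set.ncard_singleton, Module.natCard_eq_pow_finrank (K := F), hW] at hcompl
  rw [hunion, hlines, hpoints] at htotal
  obtain ⟨r, hr⟩ : ∃ r, Nat.card F = r + 2 := ⟨Nat.card F - 2, by
    have := Finite.one_lt_card (α := F); omega⟩
  rw [hr] at hTk hcompl htotal ⊢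
  have hsq : (r + 2) ^ 2 - 1 = (r + 1) * (r + 3) := by
    rw [show (r + 2) ^ 2 = (r + 1) * (r + 3) + 1 by ring]; rfl
  rw [hsq, pow_one, show r + 2 - 1 = r + 1 from rfl] at htotal
  refine Nat.eq_of_mul_eq_mul_right (Nat.succ_pos r) ?_
  zify at *
  linear_combination hcompl - htotal - (r + 1) * (r + 3 : ℤ) * hTk

/-- A family of points that is not too large admits translation vectors `f p` such that
`f p - f p'` never lies on the line joining `p` and `p'`. -/
lemma exists_sub_notMem_sup {F W : Type*} [Field F] [Finite F] [AddCommGroup W] [Module F W]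
    [Finite W] {A : Set (Submodule F W)} (hA1 : ∀ p ∈ A, finrank F p = 1)
    (hA : A.ncard * Nat.card F ^ 2 ≤ Nat.card W) :
    ∃ f : Submodule F W → W, ∀ p ∈ A, ∀ p' ∈ A, p ≠ p' → f p - f p' ∉ p ⊔ p' := by
  classical
  induction A, A.toFinite using Set.Finite.induction_on with
  | empty => simp
  | @insert a s ha hs ih =>
    have hpos : 0 < Nat.card F ^ 2 := pow_pos Nat.card_pos 2
    rw [Set.ncard_insert_of_notMem ha] at hA
    obtain ⟨f, hf⟩ := ih (fun p hp => hA1 p (Set.mem_insert_of_mem a hp)) (by nlinarith)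
    obtain ⟨w, hw⟩ : ∃ w, w ∉ ⋃ p ∈ hs.toFinset,
        Set.image (fun x => f p + x) (a ⊔ p : Submodule F W) := by
      by_contra! hcover
      have huniv : Nat.card W ≤ hs.toFinset.card * Nat.card F ^ 2 := by
        rw [← Set.ncard_univ, ← Set.eq_univ_of_forall hcover]
        refine (Finset.set_ncard_biUnion_le _ _).trans
          (Finset.sum_le_card_nsmul _ _ _ fun p hp => ?_)
        refine (Set.ncard_image_le).trans ?_
        change Nat.card (a ⊔ p : Submodule F W) ≤ _
        rw [Module.natCard_eq_pow_finrank (K := F)]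
        refine Nat.pow_le_pow_right Nat.card_pos ?_
        have hsup := Submodule.finrank_add_le_finrank_add_finrank a p
        rwa [hA1 a (Set.mem_insert a s),
          hA1 p (Set.mem_insert_of_mem a (hs.mem_toFinset.1 hp))] at hsup
      rw [← Set.ncard_eq_toFinset_card s hs] at huniv
      nlinarith
    have hwp : ∀ p ∈ s, w - f p ∉ a ⊔ p := fun p hp hmem => hw <| by
      simp only [Set.mem_iUnion]
      exact ⟨p, hs.mem_toFinset.2 hp, w - f p, hmem, by simp⟩
    have hne : ∀ p ∈ s, p ≠ a := fun p hp h => ha (h ▸ hp)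
    refine ⟨Function.update f a w, ?_⟩
    rintro p (rfl | hp) p' (rfl | hp') hpp'
    · exact absurd rfl hpp'
    · simpa [Function.update_of_ne (hne p' hp')] using hwp p' hp'
    · rw [Function.update_of_ne (hne p hp), Function.update_self, ← neg_sub, neg_mem_iff,
        sup_comm]
      exact hwp p hp
    · rw [Function.update_of_ne (hne p hp), Function.update_of_ne (hne p' hp')]
      exact hf p hp p' hp' hpp'

lemma injective_of_pairwise_disjoint {F V ι : Type*} [Field F] [AddCommGroup V] [Module F V]
    {g : ι → Submodule F V} (hg : ∀ i, g i ≠ ⊥) (hd : ∀ i j, i ≠ j → Disjoint (g i) (g j)) :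
    Function.Injective g := by
  intro i j hij
  by_contra hne
  have hdisj := hd i j hne
  rw [← hij, disjoint_self] at hdisj
  exact hg i hdisj

lemma ne_bot_of_finrank_eq_two {F V : Type*} [Field F] [AddCommGroup V] [Module F V]
    {l : Submodule F V} (hl : finrank F l = 2) : l ≠ ⊥ := by
  rintro rfl
  simp at hl

/-- If `K` is a cubic extension of a finite field `F`, then the 5-dimensional space `F² × K`
has a partial line spread of size `q ^ 3 + 1`. -/
lemma exists_partial_spread_prod {F K : Type*} [Field F] [Field K] [Algebra F K]
    [Finite K] (hK : finrank F K = 3) :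
    ∃ T : Set (Submodule F ((F × F) × K)), (∀ l ∈ T, finrank F l = 2) ∧
      T.Pairwise Disjoint ∧ T.ncard = Nat.card F ^ 3 + 1 := by
  obtain ⟨ι, hι⟩ : ∃ ι : F × F →ₗ[F] K, Function.Injective ι := by
    have : FiniteDimensional F K := FiniteDimensional.of_finrank_pos (by omega)
    let e : ((F × F) × F) ≃ₗ[F] K := LinearEquiv.ofFinrankEq _ _ (by simp [hK])
    exact ⟨e.toLinearMap ∘ₗ LinearMap.inl F (F × F) F,
      e.injective.comp LinearMap.inl_injective⟩
  let g : Option K → Submodule F ((F × F) × K) := fun o => o.elim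
    (LinearMap.range (LinearMap.inr F (F × F) K ∘ₗ ι))
    (fun a => (LinearMap.mulLeft F a ∘ₗ ι).graph)
  have hsome : ∀ (a : K) (x : (F × F) × K), x ∈ g (some a) ↔ x.2 = a * ι x.1 := fun a x => by
    simp [g, LinearMap.mem_graph_iff]
  have hnone : ∀ x ∈ g none, x.1 = 0 := by
    rintro _ ⟨y, rfl⟩
    simp
  have hg2 : ∀ o, finrank F (g o) = 2 := by
    rintro (_ | a)
    · have hinj : Function.Injective (LinearMap.inr F (F × F) K ∘ₗ ι) :=
        LinearMap.inr_injective.comp hι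
      exact (LinearMap.finrank_range_of_inj hinj).trans (by simp)
    · have hinj : Function.Injective (LinearMap.id.prod (LinearMap.mulLeft F a ∘ₗ ι)) :=
        fun x y hxy => congrArg Prod.fst hxy
      have hrange : g (some a) = LinearMap.range _ := LinearMap.graph_eq_range_prod _
      rw [hrange, LinearMap.finrank_range_of_inj hinj]
      simp
  have hns : ∀ a, Disjoint (g none) (g (some a)) := fun a => by
    rw [Submodule.disjoint_def]
    intro x hx hxa
    have hx1 := hnone x hx
    rw [hsome, hx1, map_zero, mul_zero] at hxa
    exact Prod.ext hx1 hxa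
  have hgd : ∀ o o', o ≠ o' → Disjoint (g o) (g o') := by
    rintro (_ | a) (_ | b) hab
    · exact absurd rfl hab
    · exact hns b
    · exact (hns a).symm
    · rw [Submodule.disjoint_def]
      intro x hxa hxb
      rw [hsome] at hxa hxb
      have hmul : (a - b) * ι x.1 = 0 := by rw [sub_mul, ← hxa, ← hxb, sub_self]
      have hx1 : ι x.1 = 0 := (mul_eq_zero.1 hmul).resolve_left
        (sub_ne_zero.2 fun h => hab (congrArg some h))
      refine Prod.ext ((map_eq_zero_iff ι hι).1 hx1) ?_
      rw [hxa, hx1, mul_zero]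
      rfl
  refine ⟨Set.range g, by rintro _ ⟨o, rfl⟩; exact hg2 o, ?_, ?_⟩
  · rintro _ ⟨o, rfl⟩ _ ⟨o', rfl⟩ h
    exact hgd o o' fun h' => h (congrArg g h')
  · rw [← Nat.card_coe_set_eq, Nat.card_range_of_injective
      (injective_of_pairwise_disjoint (fun o => ne_bot_of_finrank_eq_two (hg2 o)) hgd),
      Finite.card_option, Module.natCard_eq_pow_finrank (K := F), hK]

/-- The subspace of `W × F` spanned by `p × 0` and the vector `(w, 1)`. -/
def cone {F W : Type*} [Field F] [AddCommGroup W] [Module F W] (p : Submodule F W) (w : W) :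
    Submodule F (W × F) :=
  p.comap (LinearMap.fst F W F - (LinearMap.snd F W F).smulRight w)

lemma mem_cone {F W : Type*} [Field F] [AddCommGroup W] [Module F W] {p : Submodule F W} {w : W}
    {x : W × F} : x ∈ cone p w ↔ x.1 - x.2 • w ∈ p := by
  simp [cone]

lemma finrank_cone {F W : Type*} [Field F] [AddCommGroup W] [Module F W] [FiniteDimensional F W]
    (p : Submodule F W) (w : W) : finrank F (cone p w) = finrank F p + 1 := by
  let e : cone p w ≃ₗ[F] p × F :=
    { toFun := fun x => (⟨x.1.1 - x.1.2 • w, mem_cone.1 x.2⟩, x.1.2)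
      invFun := fun y => ⟨(y.1 + y.2 • w, y.2), by simp [mem_cone]⟩
      map_add' := fun x y => by ext <;> simp [add_smul]; abel
      map_smul' := fun c x => by ext <;> simp [smul_sub, mul_smul]
      left_inv := fun x => by ext <;> simp
      right_inv := fun y => by ext <;> simp }
  rw [e.finrank_eq, finrank_prod, finrank_self]

/-- The lines of `T` inside the hyperplane `W` of `W × F`, together with one further line through
each hole of `T`. -/
def coneExtension {F W : Type*} [Field F] [AddCommGroup W] [Module F W] (T : Set (Submodule F W))
    (f : Submodule F W → W) : T ⊕ holes T → Submodule F (W × F) :=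
  Sum.elim (fun l => l.1.map (LinearMap.inl F W F)) (fun p => cone p.1 (f p.1))

lemma finrank_coneExtension {F W : Type*} [Field F] [AddCommGroup W] [Module F W]
    [FiniteDimensional F W] {T : Set (Submodule F W)} (hT2 : ∀ l ∈ T, finrank F l = 2)
    (f : Submodule F W → W) (i : T ⊕ holes T) : finrank F (coneExtension T f i) = 2 := by
  rcases i with l | p
  · exact (LinearEquiv.finrank_eq (Submodule.equivMapOfInjective _ LinearMap.inl_injective
      l.1)).symm.trans (hT2 l l.2)
  · exact (finrank_cone p.1 (f p.1)).trans (by rw [p.2.1])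

lemma disjoint_coneExtension {F W : Type*} [Field F] [AddCommGroup W] [Module F W]
    {T : Set (Submodule F W)} (hT : T.Pairwise Disjoint) {f : Submodule F W → W}
    (hf : ∀ p ∈ holes T, ∀ p' ∈ holes T, p ≠ p' → f p - f p' ∉ p ⊔ p') (i j : T ⊕ holes T)
    (hij : i ≠ j) : Disjoint (coneExtension T f i) (coneExtension T f j) := by
  have hlp : ∀ (l : T) (p : holes T),
      Disjoint (coneExtension T f (Sum.inl l)) (coneExtension T f (Sum.inr p)) := by
    intro l p
    rw [Submodule.disjoint_def]
    rintro _ ⟨x, hx, rfl⟩ hxp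
    have hxp' : x ∈ p.1 := by simpa using mem_cone.1 hxp
    rw [Submodule.disjoint_def.1 (p.2.2 l l.2) x hxp' hx, map_zero]
  rcases i with l | p <;> rcases j with l' | p'
  · exact Submodule.disjoint_map LinearMap.inl_injective
      (hT l.2 l'.2 fun h => hij (congrArg Sum.inl (Subtype.ext h)))
  · exact hlp l p'
  · exact (hlp l' p).symm
  · have hne : p.1 ≠ p'.1 := fun h => hij (congrArg Sum.inr (Subtype.ext h))
    rw [Submodule.disjoint_def]
    intro x hx hx'
    replace hx := mem_cone.1 hx
    replace hx' := mem_cone.1 hx'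
    have hsmul : x.2 • (f p.1 - f p'.1) ∈ p.1 ⊔ p'.1 := by
      have := sub_mem (Submodule.mem_sup_right hx' : _ ∈ p.1 ⊔ p'.1) (Submodule.mem_sup_left hx)
      rwa [sub_sub_sub_cancel_left, ← smul_sub] at this
    have hx2 : x.2 = 0 := by
      by_contra h
      exact hf p.1 p.2 p'.1 p'.2 hne ((Submodule.smul_mem_iff _ h).1 hsmul)
    rw [hx2, zero_smul, sub_zero] at hx hx'
    exact Prod.ext (Submodule.disjoint_def.1 (pairwise_disjoint_holes T p.2 p'.2 hne) _ hx hx')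
      hx2

lemma exists_not_disjoint_coneExtension {F W : Type*} [Field F] [AddCommGroup W] [Module F W]
    (T : Set (Submodule F W)) (f : Submodule F W → W) {m : Submodule F (W × F)}
    (hm : finrank F m = 2) : ∃ i, ¬ Disjoint m (coneExtension T f i) := by
  have : FiniteDimensional F m := FiniteDimensional.of_finrank_pos (by omega)
  obtain ⟨x, hx, hx0⟩ := Submodule.exists_mem_ne_zero_of_ne_bot
    (LinearMap.ker_ne_bot_of_finrank_lt (f := LinearMap.snd F W F ∘ₗ m.subtype)
      (by rw [hm, finrank_self]; norm_num))
  obtain ⟨⟨w, c⟩, hwm⟩ := x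
  obtain rfl : c = 0 := by simpa using hx
  have hw : w ≠ 0 := by
    rintro rfl
    exact hx0 rfl
  suffices h : ∃ i, (w, (0 : F)) ∈ coneExtension T f i by
    obtain ⟨i, hi⟩ := h
    refine ⟨i, fun hd => hw ?_⟩
    exact congrArg Prod.fst (Submodule.disjoint_def.1 hd _ hwm hi)
  by_cases h : ∃ l ∈ T, w ∈ l
  · obtain ⟨l, hl, hwl⟩ := h
    exact ⟨Sum.inl ⟨l, hl⟩, w, hwl, rfl⟩
  · push Not at h
    refine ⟨Sum.inr ⟨_, span_singleton_mem_holes hw h⟩, mem_cone.2 ?_⟩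
    simp

/-- A family of pairwise disjoint lines met by every line yields a maximal partial line spread
in coordinates. -/
lemma exists_isMaximalPartialLineSpread {F V ι : Type*} [Field F] [AddCommGroup V] [Module F V]
    {n : ℕ} (e : V ≃ₗ[F] (Fin n → F)) {g : ι → Submodule F V} (hg : ∀ i, finrank F (g i) = 2)
    (hd : ∀ i j, i ≠ j → Disjoint (g i) (g j))
    (hmax : ∀ m : Submodule F V, finrank F m = 2 → ∃ i, ¬ Disjoint m (g i)) :
    ∃ S : Set (Submodule F (Fin n → F)),
      IsMaximalPartialLineSpread F n S ∧ S.ncard = Nat.card ι := by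
  let h : ι → Submodule F (Fin n → F) := fun i => (g i).map e.toLinearMap
  have hh : ∀ i, finrank F (h i) = 2 := fun i => (e.finrank_map_eq (g i)).trans (hg i)
  have hhd : ∀ i j, i ≠ j → Disjoint (h i) (h j) := fun i j hij =>
    Submodule.disjoint_map e.injective (hd i j hij)
  refine ⟨Set.range h, ⟨⟨?_, ?_⟩, fun m hm => ?_⟩, ?_⟩
  · rintro _ ⟨i, rfl⟩
    exact hh i
  · rintro _ ⟨i, rfl⟩ _ ⟨j, rfl⟩ hij
    exact (hhd i j fun h' => hij (congrArg h h')).eq_bot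
  · obtain ⟨i, hi⟩ := hmax (m.map e.symm.toLinearMap) ((e.symm.finrank_map_eq m).trans hm)
    refine ⟨h i, ⟨i, rfl⟩, fun hbot => hi ?_⟩
    rw [Submodule.disjoint_def]
    rintro _ ⟨x, hx, rfl⟩ hxi
    have hxh : x ∈ m ⊓ h i := ⟨hx, e.symm x, hxi, e.apply_symm_apply x⟩
    rw [hbot, Submodule.mem_bot] at hxh
    rw [hxh, map_zero]
  · rw [← Nat.card_coe_set_eq, Nat.card_range_of_injective
      (injective_of_pairwise_disjoint (fun i => ne_bot_of_finrank_eq_two (hh i)) hhd)]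

/-- In PG(5,q), q a prime power, for every integer `k` with
`1 ≤ k ≤ ⌊(q^3 - q^2)/(q+1)⌋` there is a maximal partial line spread of size
`q^3 + q^2 + k*q + 1`. -/
theorem stmt1 (F : Type*) [Field F] [Fintype F] (q : ℕ) (hq : Fintype.card F = q)
    (k : ℕ) (hk1 : 1 ≤ k) (hk2 : k ≤ (q ^ 3 - q ^ 2) / (q + 1)) :
    ∃ S : Set (Submodule F (Fin 6 → F)),
      IsMaximalPartialLineSpread F 6 S ∧ S.ncard = q ^ 3 + q ^ 2 + k * q + 1 := by
  subst hq
  obtain ⟨p, _⟩ := CharP.exists F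
  have : Fact p.Prime := ⟨CharP.char_is_prime F p⟩
  let K := FiniteField.Extension F p 3
  have hK : finrank F K = 3 := FiniteField.finrank_extension F p 3
  obtain ⟨T₀, hT₀2, hT₀, hT₀card⟩ := exists_partial_spread_prod hK
  rw [← Nat.card_eq_fintype_card] at hk2 ⊢
  generalize hq : Nat.card F = q at *
  have hk3 : k * (q + 1) ≤ q ^ 3 - q ^ 2 := (Nat.le_div_iff_mul_le (Nat.succ_pos q)).1 hk2
  have hqpow : q ^ 2 ≤ q ^ 3 :=
    Nat.pow_le_pow_right (hq ▸ Nat.card_pos) (by norm_num)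
  have hk : k ≤ q ^ 3 := by nlinarith [Nat.sub_le (q ^ 3) (q ^ 2)]
  obtain ⟨T, hTT₀, hTcard⟩ := Set.exists_subset_card_eq
    (show q ^ 3 + 1 - k ≤ T₀.ncard by omega)
  have hT2 : ∀ l ∈ T, finrank F l = 2 := fun l hl => hT₀2 l (hTT₀ hl)
  have hT : T.Pairwise Disjoint := hT₀.mono hTT₀
  have hW : finrank F ((F × F) × K) = 5 := by simp [hK]
  have hholes : (holes T).ncard = q ^ 2 + k * (q + 1) := by
    rw [← hq]
    exact ncard_holes hW hT2 hT (by rw [hq]; omega)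
  obtain ⟨f, hf⟩ := exists_sub_notMem_sup (A := holes T) (fun p hp => hp.1) (by
    rw [Module.natCard_eq_pow_finrank (K := F) (V := (F × F) × K), hW, hq, hholes,
      show q ^ 5 = q ^ 3 * q ^ 2 by ring]
    exact Nat.mul_le_mul_right _ (by omega))
  obtain ⟨S, hS, hScard⟩ := exists_isMaximalPartialLineSpread (n := 6)
    (LinearEquiv.ofFinrankEq (((F × F) × K) × F) (Fin 6 → F) (by simp [hK]))
    (finrank_coneExtension hT2 f) (disjoint_coneExtension hT hf)
    (fun _ => exists_not_disjoint_coneExtension T f)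
  refine ⟨S, hS, ?_⟩
  rw [hScard, Nat.card_sum, Nat.card_coe_set_eq, Nat.card_coe_set_eq, hTcard, hholes, mul_add]
  omega
end

section
/- In PG(5,q), q a prime power, there exists a maximal partial line spread of size q^3 + q^2 + 1. -/
open Module

/-- Pairwise skew lines, given as the images of injective linear maps from a 2-dimensional space,
form a maximal partial line spread as soon as they cover the kernel of a linear functional. -/
theorem isMaximalPartialLineSpread_range {F L ι : Type*} [Field F] [AddCommGroup L] [Module F L]
    {n : ℕ} (φ : ι → L →ₗ[F] (Fin n → F)) (f : (Fin n → F) →ₗ[F] F) (hL : finrank F L = 2)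
    (hinj : ∀ i, Function.Injective (φ i))
    (hskew : ∀ i j x y, φ i x = φ j y → i ≠ j → x = 0)
    (hcover : ∀ v, f v = 0 → ∃ i x, φ i x = v) :
    IsMaximalPartialLineSpread F n (Set.range fun i => LinearMap.range (φ i)) := by
  refine ⟨⟨?_, ?_⟩, fun m hm => ?_⟩
  · rintro _ ⟨i, rfl⟩
    rw [LinearMap.finrank_range_of_inj (hinj i), hL]
  · rintro _ ⟨i, rfl⟩ _ ⟨j, rfl⟩ hij
    rw [Submodule.eq_bot_iff]
    rintro _ ⟨⟨x, rfl⟩, ⟨y, hy⟩⟩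
    rw [hskew i j x y hy.symm fun h => hij (by rw [h]), map_zero]
  · have hker : LinearMap.ker (f.domRestrict m) ≠ ⊥ :=
      LinearMap.ker_ne_bot_of_finrank_lt (by rw [finrank_self, hm]; norm_num)
    obtain ⟨v, hv, hv0⟩ := Submodule.exists_mem_ne_zero_of_ne_bot hker
    obtain ⟨i, x, hx⟩ := hcover v hv
    refine ⟨_, ⟨i, rfl⟩, fun h => hv0 ?_⟩
    exact Subtype.ext ((Submodule.eq_bot_iff _).mp h v ⟨v.2, x, hx⟩)

/-- Pairwise skew injective images of a nontrivial space are distinct. -/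
theorem injective_range_of_skew {F L V ι : Type*} [Field F] [AddCommGroup L] [Module F L]
    [Nontrivial L] [AddCommGroup V] [Module F V] (φ : ι → L →ₗ[F] V)
    (hskew : ∀ i j x y, φ i x = φ j y → i ≠ j → x = 0) :
    Function.Injective fun i => LinearMap.range (φ i) := by
  intro i j hij
  by_contra hne
  obtain ⟨x, hx⟩ := exists_ne (0 : L)
  have hmem : φ i x ∈ LinearMap.range (φ j) := hij.le (LinearMap.mem_range_self (φ i) x)
  obtain ⟨y, hy⟩ := hmem
  exact hx (hskew i j x y hy.symm hne)

section Construction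

variable {F K L : Type*} [Field F] [Field K] [Field L] [Algebra F K] [Algebra F L]

/-- Parametrizations of lines of `L × K × F`, where `K` and `L` are extensions of `F`. The lines
indexed by `K` partition the points of the hyperplane `L × K × 0` outside the plane `0 × K × 0`;
those indexed by `Option L` form a regular line spread of the solid `0 × K × F`. -/
def spreadLine (ι : L →ₗ[F] K) (g : (K × F) ≃ₗ[F] L × L) :
    K ⊕ Option L → L →ₗ[F] L × K × F
  | .inl c => LinearMap.id.prod ((LinearMap.mulRight F c ∘ₗ ι).prod 0)
  | .inr none => LinearMap.inr F L (K × F) ∘ₗ g.symm.toLinearMap ∘ₗ LinearMap.inr F L L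
  | .inr (some d) =>
    LinearMap.inr F L (K × F) ∘ₗ g.symm.toLinearMap ∘ₗ LinearMap.id.prod (LinearMap.mulRight F d)

variable (ι : L →ₗ[F] K) (g : (K × F) ≃ₗ[F] L × L)

theorem spreadLine_inl (c : K) (x : L) : spreadLine ι g (.inl c) x = (x, ι x * c, 0) := rfl

theorem spreadLine_none (x : L) : spreadLine ι g (.inr none) x = (0, g.symm (0, x)) := rfl

theorem spreadLine_some (d x : L) :
    spreadLine ι g (.inr (some d)) x = (0, g.symm (x, x * d)) := rfl

theorem spreadLine_injective (i : K ⊕ Option L) : Function.Injective (spreadLine ι g i) := by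
  intro x y h
  rcases i with c | _ | d
  · simp only [spreadLine_inl, Prod.mk.injEq] at h
    exact h.1
  · simpa [spreadLine_none] using h
  · simp only [spreadLine_some, Prod.mk.injEq, EmbeddingLike.apply_eq_iff_eq] at h
    exact h.2.1

theorem spreadLine_skew (hι : Function.Injective ι) (i j : K ⊕ Option L) (x y : L)
    (h : spreadLine ι g i x = spreadLine ι g j y) (hij : i ≠ j) : x = 0 := by
  rcases i with c | _ | d <;> rcases j with c' | _ | d' <;>
    simp only [spreadLine_inl, spreadLine_none, spreadLine_some, Prod.mk.injEq,
      EmbeddingLike.apply_eq_iff_eq] at h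
  · obtain ⟨rfl, h, -⟩ := h
    by_contra hx
    exact hij (congrArg _ (mul_left_cancel₀ ((map_ne_zero_iff ι hι).mpr hx) h))
  · exact h.1
  · exact h.1
  · obtain ⟨rfl, h⟩ := h
    rw [map_zero ι, zero_mul, Prod.mk_zero_zero, g.symm.map_eq_zero_iff, Prod.mk_eq_zero] at h
    exact h.2
  · exact absurd rfl hij
  · obtain ⟨-, rfl, h⟩ := h
    simpa using h
  · obtain ⟨rfl, h⟩ := h
    rw [map_zero ι, zero_mul, Prod.mk_zero_zero, g.symm.map_eq_zero_iff, Prod.mk_eq_zero] at h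
    exact h.1
  · exact h.2.1
  · obtain ⟨-, rfl, h⟩ := h
    by_contra hx
    exact hij (congrArg (fun d => Sum.inr (some d)) (mul_left_cancel₀ hx h))

theorem exists_spreadLine_eq (hι : Function.Injective ι) (v : L × K × F) (hv : v.2.2 = 0) :
    ∃ i x, spreadLine ι g i x = v := by
  obtain ⟨x, w⟩ := v
  by_cases hx : x = 0
  · subst hx
    obtain ⟨⟨s, t⟩, rfl⟩ := g.symm.surjective w
    by_cases hs : s = 0
    · exact ⟨.inr none, t, by rw [spreadLine_none, hs]⟩
    · exact ⟨.inr (some (t / s)), s, by rw [spreadLine_some, mul_div_cancel₀ _ hs]⟩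
  · obtain ⟨k, a⟩ := w
    obtain rfl : a = 0 := hv
    exact ⟨.inl (k / ι x), x, by
      rw [spreadLine_inl, mul_div_cancel₀ _ ((map_ne_zero_iff ι hι).mpr hx)]⟩

end Construction

/-- In PG(5,q), q a prime power, there is a maximal partial line spread of size
`q^3 + q^2 + 1`. -/
theorem stmt2 (F : Type*) [Field F] [Fintype F] (q : ℕ) (hq : Fintype.card F = q) :
    ∃ S : Set (Submodule F (Fin 6 → F)),
      IsMaximalPartialLineSpread F 6 S ∧ S.ncard = q ^ 3 + q ^ 2 + 1 := by
  obtain ⟨p, hchar⟩ := CharP.exists F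
  have : Fact p.Prime := ⟨CharP.char_is_prime F p⟩
  let K := FiniteField.Extension F p 3
  let L := FiniteField.Extension F p 2
  have hK : finrank F K = 3 := FiniteField.finrank_extension F p 3
  have hL : finrank F L = 2 := FiniteField.finrank_extension F p 2
  obtain ⟨ι, hι⟩ := finrank_le_iff_exists_linearMap.mp (show finrank F L ≤ finrank F K by lia)
  let g : (K × F) ≃ₗ[F] L × L := LinearEquiv.ofFinrankEq _ _ (by simp [hK, hL])
  let e : (L × K × F) ≃ₗ[F] (Fin 6 → F) := LinearEquiv.ofFinrankEq _ _ (by simp [hK, hL])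
  let φ : K ⊕ Option L → L →ₗ[F] (Fin 6 → F) := fun i => e.toLinearMap ∘ₗ spreadLine ι g i
  let f : (Fin 6 → F) →ₗ[F] F :=
    LinearMap.snd F K F ∘ₗ LinearMap.snd F L (K × F) ∘ₗ e.symm.toLinearMap
  have hskew : ∀ i j x y, φ i x = φ j y → i ≠ j → x = 0 := fun i j x y h =>
    spreadLine_skew ι g hι i j x y (e.injective h)
  refine ⟨Set.range fun i => LinearMap.range (φ i),
    isMaximalPartialLineSpread_range φ f hL
      (fun i => e.injective.comp (spreadLine_injective ι g i)) hskew fun v hv => ?_, ?_⟩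
  · obtain ⟨i, x, hx⟩ := exists_spreadLine_eq ι g hι (e.symm v) hv
    exact ⟨i, x, (congrArg e hx).trans (e.apply_symm_apply v)⟩
  · rw [Set.ncard_range_of_injective (injective_range_of_skew φ hskew), Nat.card_sum,
      Finite.card_option, FiniteField.natCard_extension, FiniteField.natCard_extension,
      Nat.card_eq_fintype_card, hq, add_assoc]
end

section
/- Every maximal partial line spread of PG(5,q), q a prime power, has size at least q^3 + q^2 + 1. -/
open Module Finset
open scoped Classical

section Counting

variable {F V : Type*} [Field F] [Fintype F] [AddCommGroup V] [Module F V] [Fintype V]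

/-- A subspace of dimension `d` over the field with `q` elements has `q ^ d` vectors. -/
theorem card_filter_mem_submodule (U : Submodule F V) :
    #{v : V | v ∈ U} = Fintype.card F ^ finrank F U := by
  rw [← Fintype.card_subtype, ← Nat.card_eq_fintype_card, ← Nat.card_eq_fintype_card]
  exact Module.natCard_eq_pow_finrank (K := F) (V := U)

/-- The nonzero vectors of a cone are divided into classes of `q - 1` proportional vectors. -/
theorem card_sub_one_dvd_card_cone (B : Finset V) (hB : ∀ (c : F), ∀ b ∈ B, c • b ∈ B) :
    Fintype.card F - 1 ∣ #{b ∈ B | b ≠ 0} := by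
  rw [Finset.card_eq_sum_card_image (fun v : V => F ∙ v)]
  refine Finset.dvd_sum fun l hl => ?_
  obtain ⟨b, hb, rfl⟩ := Finset.mem_image.1 hl
  obtain ⟨hbB, hb0⟩ := Finset.mem_filter.1 hb
  have : (Finset.univ.filter fun v : V => v ∈ F ∙ b).erase 0
      = ({x ∈ B | x ≠ 0} : Finset V).filter fun v => (F ∙ v) = F ∙ b := by
    ext v
    simp only [Finset.mem_erase, Finset.mem_filter, Finset.mem_univ, true_and]
    constructor
    · rintro ⟨hv0, hv⟩
      obtain ⟨c, rfl⟩ := Submodule.mem_span_singleton.1 hv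
      have hc : c ≠ 0 := by rintro rfl; simp at hv0
      exact ⟨⟨hB c b hbB, hv0⟩, Submodule.span_singleton_smul_eq hc.isUnit b⟩
    · rintro ⟨⟨-, hv0⟩, hv⟩
      exact ⟨hv0, hv ▸ Submodule.mem_span_singleton_self v⟩
  rw [← this, Finset.card_erase_of_mem (by simp), card_filter_mem_submodule,
    finrank_span_singleton hb0, pow_one]

/-- If `B` meets every line through a point `R` outside `B`, then at least `q ^ (d + 1) - q ^ d`
vectors of `B` lie outside a given hyperplane through `R`. -/
theorem pow_sub_pow_le_card_filter_apply_ne_zero {d : ℕ} (hd : finrank F V = d + 2)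
    (B : Finset V) (h0 : 0 ∈ B) (hB : ∀ (c : F), ∀ b ∈ B, c • b ∈ B)
    (hblock : ∀ m : Submodule F V, finrank F m = 2 → ∃ v ∈ B, v ∈ m ∧ v ≠ 0)
    {φ : Dual F V} {R : V} (hR : φ R = 0) (hRB : R ∉ B) (hφ : φ ≠ 0) :
    (Fintype.card F : ℤ) ^ (d + 1) - (Fintype.card F : ℤ) ^ d ≤ #{b ∈ B | φ b ≠ 0} := by
  have hker := φ.finrank_ker_add_one_of_ne_zero hφ
  have hout : ((#{v : V | φ v ≠ 0} : ℕ) : ℤ)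
      = (Fintype.card F : ℤ) ^ (d + 2) - (Fintype.card F : ℤ) ^ (d + 1) := by
    have h1 := card_filter_mem_submodule (⊤ : Submodule F V)
    have h2 := card_filter_mem_submodule (LinearMap.ker φ)
    have h3 := Finset.card_filter_add_card_filter_not (s := (Finset.univ : Finset V))
      (fun v => φ v = 0)
    simp only [LinearMap.mem_ker] at h2
    simp only [Submodule.mem_top, Finset.filter_true, finrank_top] at h1
    rw [h1, h2, show finrank F (LinearMap.ker φ) = d + 1 by lia, hd] at h3
    zify at h3
    linarith
  have hsurj : (Finset.univ.filter fun v : V => φ v ≠ 0) ⊆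
      (({b ∈ B | φ b ≠ 0} : Finset V) ×ˢ (Finset.univ : Finset F)).image
        (fun p => p.1 - p.2 • R) := by
    intro v hv
    have hv : φ v ≠ 0 := (Finset.mem_filter.1 hv).2
    have hR0 : R ≠ 0 := fun h => hRB (h ▸ h0)
    have hli : LinearIndependent F ![v, R] := by
      rw [LinearIndependent.pair_iff]
      intro s t hst
      have hs : s = 0 := by
        have := congrArg φ hst
        simpa [hR, hv] using this
      subst hs
      simpa [hR0] using hst
    have hdim : finrank F (Submodule.span F (Set.range ![v, R])) = 2 := by
      simpa using finrank_span_eq_card hli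
    obtain ⟨w, hwB, hw, hw0⟩ := hblock _ hdim
    rw [Matrix.range_cons, Matrix.range_cons, Matrix.range_empty, Set.union_empty,
      Set.singleton_union, Submodule.mem_span_pair] at hw
    obtain ⟨s, t, rfl⟩ := hw
    have hs : s ≠ 0 := by
      rintro rfl
      have ht : t ≠ 0 := by rintro rfl; simp at hw0
      apply hRB
      simpa [smul_smul, ht] using hB t⁻¹ _ hwB
    refine Finset.mem_image.2 ⟨(v + (s⁻¹ * t) • R, s⁻¹ * t), ?_, by simp⟩
    simp only [Finset.mem_product, Finset.mem_filter, Finset.mem_univ, and_true]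
    refine ⟨?_, by simpa [hR] using hv⟩
    simpa [smul_smul, hs] using hB s⁻¹ _ hwB
  have hle := (Finset.card_le_card hsurj).trans Finset.card_image_le
  rw [Finset.card_product, Finset.card_univ] at hle
  zify at hle
  rw [hout] at hle
  have hq : (0 : ℤ) < Fintype.card F := mod_cast Fintype.card_pos
  refine le_of_mul_le_mul_right ?_ hq
  calc _ = (Fintype.card F : ℤ) ^ (d + 2) - (Fintype.card F : ℤ) ^ (d + 1) := by ring
    _ ≤ _ := hle

variable [Fintype (Dual F V)]

/-- The number of linear forms that vanish on a subspace. -/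
theorem card_filter_dualAnnihilator (U : Submodule F V) {r : ℕ}
    (hr : finrank F U + r = finrank F V) :
    #{φ : Dual F V | φ ∈ U.dualAnnihilator} = Fintype.card F ^ r := by
  rw [card_filter_mem_submodule]
  have h := Subspace.finrank_add_finrank_dualAnnihilator_eq U
  congr 1
  lia

/-- Among the linear forms vanishing on `U`, those not vanishing at a vector outside `U`. -/
theorem card_dualAnnihilator_apply_ne_zero (U : Submodule F V) {r : ℕ}
    (hr : finrank F U + (r + 1) = finrank F V) {b : V} (hb : b ∉ U) :
    (#{φ : Dual F V | φ ∈ U.dualAnnihilator ∧ φ b ≠ 0} : ℤ)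
      = (Fintype.card F : ℤ) ^ (r + 1) - (Fintype.card F : ℤ) ^ r := by
  have hspan : finrank F ↥(U ⊔ F ∙ b) = finrank F U + 1 := by
    have hb0 : b ≠ 0 := fun h => hb (h ▸ U.zero_mem)
    have h := Submodule.finrank_sup_add_finrank_inf_eq U (F ∙ b)
    have hinf : U ⊓ (F ∙ b) = ⊥ :=
      ((Submodule.disjoint_span_singleton' hb0).2 hb).eq_bot
    rw [hinf, finrank_bot, finrank_span_singleton hb0] at h
    exact h
  have hsub : (Finset.univ.filter fun φ : Dual F V => φ ∈ (U ⊔ F ∙ b).dualAnnihilator)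
      = Finset.univ.filter fun φ : Dual F V => φ ∈ U.dualAnnihilator ∧ φ b = 0 := by
    ext φ
    simp only [Finset.mem_filter, Finset.mem_univ, true_and,
      Submodule.dualAnnihilator_sup_eq, Submodule.mem_inf, Submodule.mem_dualAnnihilator,
      Submodule.mem_span_singleton, forall_exists_index, forall_apply_eq_imp_iff, map_smul,
      smul_eq_mul]
    exact and_congr_right fun _ => ⟨fun h => by simpa using h 1, fun h c => by simp [h]⟩
  have h1 := card_filter_dualAnnihilator U hr
  have h2 := card_filter_dualAnnihilator (U ⊔ F ∙ b) (r := r) (by lia)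
  rw [hsub] at h2
  have h3 := Finset.card_filter_add_card_filter_not
    (s := Finset.univ.filter fun φ : Dual F V => φ ∈ U.dualAnnihilator) (fun φ => φ b = 0)
  rw [Finset.filter_filter, Finset.filter_filter, h1, h2] at h3
  zify at h3
  linarith

/-- Double counting of the pairs of a vector of `B` and a linear form vanishing on `U` but not
at the vector. -/
theorem sum_card_filter_apply_ne_zero (U : Submodule F V) {r : ℕ}
    (hr : finrank F U + (r + 1) = finrank F V) (B : Finset V) :
    ∑ φ : Dual F V with φ ∈ U.dualAnnihilator, (#{b ∈ B | φ b ≠ 0} : ℤ)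
      = #{b ∈ B | b ∉ U} * ((Fintype.card F : ℤ) ^ (r + 1) - (Fintype.card F : ℤ) ^ r) := by
  have h := Finset.sum_card_bipartiteAbove_eq_sum_card_bipartiteBelow
    (s := Finset.univ.filter fun φ : Dual F V => φ ∈ U.dualAnnihilator) (t := B)
    (fun φ b => φ b ≠ 0)
  simp only [Finset.bipartiteAbove, Finset.bipartiteBelow, Finset.filter_filter] at h
  rw [← Nat.cast_sum, h, Nat.cast_sum, ← Finset.sum_filter_add_sum_filter_not B (fun b => b ∉ U),
    Finset.sum_congr rfl fun b hb => card_dualAnnihilator_apply_ne_zero U hr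
      (Finset.mem_filter.1 hb).2, Finset.sum_const, nsmul_eq_mul, add_eq_left]
  refine Finset.sum_eq_zero fun b hb => ?_
  have hbU : b ∈ U := not_not.1 (Finset.mem_filter.1 hb).2
  rw [Nat.cast_eq_zero, Finset.card_eq_zero, Finset.filter_eq_empty_iff]
  rintro φ - ⟨hφ, hne⟩
  exact hne ((Submodule.mem_dualAnnihilator φ).1 hφ b hbU)

end Counting

section Blocking

variable {F V : Type*} [Field F] [Fintype F] [AddCommGroup V] [Module F V] [Fintype V]
  [Fintype (Dual F V)]

/-- A cone that is small in the whole space is small, by averaging, in some hyperplane. -/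
theorem exists_hyperplane_card_lt {n : ℕ} (hd : finrank F V = n + 3)
    (B : Finset V) (h0 : 0 ∈ B) (hB : ∀ (c : F), ∀ b ∈ B, c • b ∈ B)
    (hcard : (Fintype.card F : ℤ) * #B
      < (Fintype.card F : ℤ) ^ (n + 3) + (Fintype.card F : ℤ) ^ (n + 2)
        - (Fintype.card F : ℤ) ^ (n + 1)) :
    ∃ φ : Dual F V, φ ≠ 0 ∧ (Fintype.card F : ℤ) * #{b ∈ B | φ b = 0}
      < (Fintype.card F : ℤ) ^ (n + 2) + (Fintype.card F : ℤ) ^ (n + 1)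
        - (Fintype.card F : ℤ) ^ n := by
  by_contra! hcon
  have hsum := sum_card_filter_apply_ne_zero (⊥ : Submodule F V) (r := n + 2)
    (by rw [finrank_bot, hd]; ring) B
  have hdvd := card_sub_one_dvd_card_cone B hB
  have hforms := card_filter_dualAnnihilator (⊥ : Submodule F V) (r := n + 3)
    (by rw [finrank_bot, hd]; ring)
  have hB0 : #{b ∈ B | b ≠ 0} + 1 = #B := by
    rw [Finset.filter_ne', Finset.card_erase_add_one h0]
  have hq : (1 : ℤ) < Fintype.card F := mod_cast Fintype.one_lt_card
  simp only [Submodule.dualAnnihilator_bot, Submodule.mem_top, Finset.filter_true,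
    Submodule.mem_bot] at hsum hforms
  have hforms' : (#(Finset.univ.erase (0 : Dual F V)) : ℤ)
      = (Fintype.card F : ℤ) ^ (n + 3) - 1 := by
    rw [eq_sub_iff_add_eq]
    exact_mod_cast (Finset.card_erase_add_one (Finset.mem_univ _)).trans hforms
  rw [← Finset.add_sum_erase _ _ (Finset.mem_univ 0)] at hsum
  simp only [LinearMap.zero_apply, ne_eq, not_true_eq_false, Finset.filter_false,
    Finset.card_empty, Nat.cast_zero, zero_add] at hsum
  have hq1 : ((Fintype.card F - 1 : ℕ) : ℤ) = (Fintype.card F : ℤ) - 1 := by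
    rw [Nat.cast_sub Fintype.card_pos, Nat.cast_one]
  have hdvd' : ((Fintype.card F : ℤ) - 1) ∣ (#{b ∈ B | b ≠ 0} : ℤ) := by
    rw [← hq1]
    exact_mod_cast hdvd
  have hM : (#{b ∈ B | b ≠ 0} : ℤ) = #B - 1 := by
    rw [← hB0]; push_cast; ring
  have hle := Finset.sum_le_card_nsmul (Finset.univ.erase (0 : Dual F V))
    (fun φ => (Fintype.card F : ℤ) * (#{b ∈ B | φ b ≠ 0} : ℤ))
    ((Fintype.card F : ℤ) * #B - ((Fintype.card F : ℤ) ^ (n + 2) + (Fintype.card F : ℤ) ^ (n + 1)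
        - (Fintype.card F : ℤ) ^ n)) (fun φ hφ => by
      have h1 := hcon φ (Finset.ne_of_mem_erase hφ)
      have h2 := Finset.card_filter_add_card_filter_not (s := B) (fun b => φ b = 0)
      rw [← h2]
      push_cast
      simp only [ne_eq]
      linarith)
  rw [← Finset.mul_sum, nsmul_eq_mul, hforms'] at hle
  simp only [ne_eq] at hle hM hdvd'
  rw [hsum, hM, show n + 2 + 1 = n + 3 from rfl] at hle
  rw [hM] at hdvd'
  generalize (#B : ℤ) = M at *
  generalize (Fintype.card F : ℤ) = q at *
  have ha : (1 : ℤ) ≤ q ^ n := one_le_pow₀ hq.le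
  have hgap : q - 1 ≤ q ^ (n + 2) + q ^ (n + 1) - q ^ n - M := by
    refine Int.le_of_dvd ?_ ?_
    · have : q * 0 < q * (q ^ (n + 2) + q ^ (n + 1) - q ^ n - M) := by
        linear_combination hcard
      exact lt_of_mul_lt_mul_left this (by linarith)
    · have h : q ^ (n + 2) + q ^ (n + 1) - q ^ n - M
          = (q ^ (n + 2) - 1) + (q - 1) * q ^ n - (M - 1) := by ring
      rw [h]
      exact ((sub_one_dvd_pow_sub_one q _).add (dvd_mul_right _ _)).sub hdvd'
  set a := q ^ n with ha'
  have e1 : q ^ (n + 1) = a * q := pow_succ _ _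
  have e2 : q ^ (n + 2) = a * q ^ 2 := pow_add _ _ _
  have e3 : q ^ (n + 3) = a * q ^ 3 := pow_add _ _ _
  rw [e1, e2] at hgap
  rw [e3, e2, e1] at hle
  have hpos : 0 < a * q ^ 3 - q := by
    nlinarith [mul_pos (by linarith : 0 < a) (by linarith : 0 < q)]
  have h1 := mul_le_mul_of_nonneg_right hgap hpos.le
  have h2 : 0 < (q - 1) * (a * q ^ 2 + a * q - a - q) := by
    apply mul_pos (by linarith)
    nlinarith [mul_pos (by linarith : 0 < a) (by linarith : 0 < q)]
  nlinarith

/-- If a cone `B` meeting all lines contains a subspace of codimension two, then it contains a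
hyperplane or is large. -/
theorem exists_hyperplane_subset_of_subspace_subset {n : ℕ} (hd : finrank F V = n + 3)
    (B : Finset V) (h0 : 0 ∈ B) (hB : ∀ (c : F), ∀ b ∈ B, c • b ∈ B)
    (hblock : ∀ m : Submodule F V, finrank F m = 2 → ∃ v ∈ B, v ∈ m ∧ v ≠ 0)
    (hcard : (Fintype.card F : ℤ) * #B
      < (Fintype.card F : ℤ) ^ (n + 3) + (Fintype.card F : ℤ) ^ (n + 2)
        - (Fintype.card F : ℤ) ^ (n + 1))
    (U : Submodule F V) (hU : finrank F U = n + 1) (hUB : ∀ u ∈ U, u ∈ B) :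
    ∃ H : Submodule F V, finrank F H = n + 2 ∧ ∀ u ∈ H, u ∈ B := by
  by_contra! hcon
  have hsum := sum_card_filter_apply_ne_zero U (r := 1) (by lia) B
  have hforms := card_filter_dualAnnihilator U (r := 2) (by lia)
  have hmem : (0 : Dual F V) ∈ Finset.univ.filter fun φ : Dual F V => φ ∈ U.dualAnnihilator := by
    simp
  have hq : (1 : ℤ) < Fintype.card F := mod_cast Fintype.one_lt_card
  have hforms' : (#((Finset.univ.filter fun φ : Dual F V => φ ∈ U.dualAnnihilator).erase 0) : ℤ)
      = (Fintype.card F : ℤ) ^ 2 - 1 := by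
    rw [eq_sub_iff_add_eq]
    exact_mod_cast (Finset.card_erase_add_one hmem).trans hforms
  rw [← Finset.add_sum_erase _ _ hmem] at hsum
  simp only [LinearMap.zero_apply, ne_eq, not_true_eq_false, Finset.filter_false,
    Finset.card_empty, Nat.cast_zero, zero_add] at hsum
  have hle := Finset.card_nsmul_le_sum
    ((Finset.univ.filter fun φ : Dual F V => φ ∈ U.dualAnnihilator).erase 0)
    (fun φ => (#{b ∈ B | φ b ≠ 0} : ℤ))
    ((Fintype.card F : ℤ) ^ (n + 2) - (Fintype.card F : ℤ) ^ (n + 1)) (fun φ hφ => by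
      have hφ0 := Finset.ne_of_mem_erase hφ
      have hker := φ.finrank_ker_add_one_of_ne_zero hφ0
      obtain ⟨R, hR, hRB⟩ := hcon (LinearMap.ker φ) (by lia)
      exact pow_sub_pow_le_card_filter_apply_ne_zero (d := n + 1) hd B h0 hB hblock hR hRB hφ0)
  simp only [ne_eq] at hle
  rw [nsmul_eq_mul, hforms', hsum] at hle
  have hBU : (#{b ∈ B | b ∉ U} : ℤ) = #B - (Fintype.card F : ℤ) ^ (n + 1) := by
    have h1 := Finset.card_filter_add_card_filter_not (s := B) (fun b => b ∈ U)
    have h2 : B.filter (fun b => b ∈ U) = Finset.univ.filter fun b => b ∈ U := by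
      ext b
      simpa using hUB b
    rw [h2, card_filter_mem_submodule, hU] at h1
    zify at h1
    linarith
  rw [hBU] at hle
  generalize (#B : ℤ) = M at *
  generalize (Fintype.card F : ℤ) = q at *
  have h : (q - 1) * (q ^ (n + 3) + q ^ (n + 2) - q ^ (n + 1)) ≤ (q - 1) * (q * M) := by
    linear_combination hle
  exact absurd (le_of_mul_le_mul_left h (by linarith)) (not_le.2 hcard)

end Blocking

/-- A set of points of `PG(n + 1, q)` that meets every line and has fewer than `q ^ (n - 1)`
points more than a hyperplane contains a hyperplane. The set is given by the cone `B` of its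
vectors, so that the size condition reads `q * #B < q ^ (n + 2) + q ^ (n + 1) - q ^ n`. -/
theorem exists_hyperplane_subset_of_blocking {F : Type*} [Field F] [Fintype F] (n : ℕ) :
    ∀ {V : Type*} [AddCommGroup V] [Module F V] [Fintype V], finrank F V = n + 2 →
      ∀ B : Finset V, 0 ∈ B → (∀ (c : F), ∀ b ∈ B, c • b ∈ B) →
      (∀ m : Submodule F V, finrank F m = 2 → ∃ v ∈ B, v ∈ m ∧ v ≠ 0) →
      (Fintype.card F : ℤ) * #B
        < (Fintype.card F : ℤ) ^ (n + 2) + (Fintype.card F : ℤ) ^ (n + 1)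
          - (Fintype.card F : ℤ) ^ n →
      ∃ U : Submodule F V, finrank F U = n + 1 ∧ ∀ u ∈ U, u ∈ B := by
  induction n with
  | zero =>
    intro V _ _ _ hd B _ hB hblock _
    obtain ⟨b, hb, -, hb0⟩ := hblock ⊤ (by simpa using hd)
    refine ⟨F ∙ b, by simpa using finrank_span_singleton hb0, fun u hu => ?_⟩
    obtain ⟨c, rfl⟩ := Submodule.mem_span_singleton.1 hu
    exact hB c b hb
  | succ n ih =>
    intro V _ _ _ hd B h0 hB hblock hcard
    have : Finite (Dual F V) := Module.finite_of_finite F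
    have : Fintype (Dual F V) := Fintype.ofFinite _
    obtain ⟨φ, hφ, hφcard⟩ := exists_hyperplane_card_lt hd B h0 hB hcard
    have hker := φ.finrank_ker_add_one_of_ne_zero hφ
    obtain ⟨U, hU, hUB⟩ := ih (V := LinearMap.ker φ) (by lia)
      (Finset.univ.filter fun v => (v : V) ∈ B) (by simpa using h0)
      (fun c b hb => by simpa using hB c b (by simpa using hb))
      (fun m hm => by
        obtain ⟨v, hvB, hvm, hv0⟩ := hblock (m.map (LinearMap.ker φ).subtype)
          ((Submodule.finrank_map_subtype_eq _ m).trans hm)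
        obtain ⟨w, hw, rfl⟩ := Submodule.mem_map.1 hvm
        exact ⟨w, by simpa using hvB, hw, fun h => hv0 (by simp [h])⟩)
      (by
        refine lt_of_eq_of_lt ?_ hφcard
        congr 2
        refine Finset.card_bij (fun v _ => (v : V)) (fun v hv => ?_) (fun _ _ _ _ h => ?_)
          fun v hv => ?_
        · exact Finset.mem_filter.2 ⟨(Finset.mem_filter.1 hv).2, v.2⟩
        · exact Subtype.ext h
        · obtain ⟨hvB, hvφ⟩ := Finset.mem_filter.1 hv
          exact ⟨⟨v, hvφ⟩, by simpa using hvB, rfl⟩)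
    refine exists_hyperplane_subset_of_subspace_subset hd B h0 hB hblock hcard
      (U.map (LinearMap.ker φ).subtype) ?_ ?_
    · exact (Submodule.finrank_map_subtype_eq _ U).trans hU
    · intro u hu
      obtain ⟨w, hw, rfl⟩ := Submodule.mem_map.1 hu
      simpa using hUB w hw

section Spread

variable {F V : Type*} [Field F] [Fintype F] [AddCommGroup V] [Module F V] [Fintype V]

/-- The nonzero vectors of `W` covered by pairwise skew subspaces. -/
theorem card_covered_eq_sum (S : Finset (Submodule F V))
    (hskew : ∀ l ∈ S, ∀ l' ∈ S, l ≠ l' → l ⊓ l' = ⊥) (W : Submodule F V) :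
    (#{v : V | v ≠ 0 ∧ v ∈ W ∧ ∃ l ∈ S, v ∈ l} : ℤ)
      = ∑ l ∈ S, ((Fintype.card F : ℤ) ^ finrank F ↥(l ⊓ W) - 1) := by
  have hunion : (Finset.univ.filter fun v : V => v ≠ 0 ∧ v ∈ W ∧ ∃ l ∈ S, v ∈ l)
      = S.biUnion fun l => (Finset.univ.filter fun v : V => v ∈ l ⊓ W).erase 0 := by
    ext v
    simp only [Finset.mem_filter, Finset.mem_univ, true_and, Finset.mem_biUnion,
      Finset.mem_erase, Submodule.mem_inf]
    exact ⟨fun ⟨h0, hW, l, hl, hv⟩ => ⟨l, hl, h0, hv, hW⟩,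
      fun ⟨l, hl, h0, hv, hW⟩ => ⟨h0, hW, l, hl, hv⟩⟩
  rw [hunion, Finset.card_biUnion, Nat.cast_sum]
  · refine Finset.sum_congr rfl fun l _ => ?_
    rw [eq_sub_iff_add_eq]
    exact_mod_cast (Finset.card_erase_add_one (by simp)).trans (card_filter_mem_submodule (l ⊓ W))
  · intro l hl l' hl' hne
    refine Finset.disjoint_left.2 fun v hv hv' => ?_
    simp only [Finset.mem_erase, Finset.mem_filter, Finset.mem_univ, true_and,
      Submodule.mem_inf] at hv hv'
    have : v ∈ l ⊓ l' := ⟨hv.2.1, hv'.2.1⟩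
    rw [hskew l hl l' hl' hne, Submodule.mem_bot] at this
    exact hv.1 this

/-- The nonzero vectors of a hyperplane covered by pairwise skew lines. -/
theorem card_covered_hyperplane (S : Finset (Submodule F V))
    (hline : ∀ l ∈ S, finrank F l = 2)
    (hskew : ∀ l ∈ S, ∀ l' ∈ S, l ≠ l' → l ⊓ l' = ⊥) (W : Submodule F V)
    (hW : finrank F W + 1 = finrank F V) :
    (#{v : V | v ≠ 0 ∧ v ∈ W ∧ ∃ l ∈ S, v ∈ l} : ℤ)
      = ((Fintype.card F : ℤ) - 1) * (#S + Fintype.card F * #{l ∈ S | l ≤ W}) := by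
  rw [card_covered_eq_sum S hskew, ← Finset.sum_filter_add_sum_filter_not S (fun l => l ≤ W)]
  have hin : ∀ l ∈ S.filter (fun l => l ≤ W),
      (Fintype.card F : ℤ) ^ finrank F ↥(l ⊓ W) - 1 = (Fintype.card F : ℤ) ^ 2 - 1 := by
    intro l hl
    obtain ⟨hl, hlW⟩ := Finset.mem_filter.1 hl
    rw [inf_eq_left.2 hlW, hline l hl]
  have hout : ∀ l ∈ S.filter (fun l => ¬ l ≤ W),
      (Fintype.card F : ℤ) ^ finrank F ↥(l ⊓ W) - 1 = (Fintype.card F : ℤ) - 1 := by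
    intro l hl
    obtain ⟨hl, hlW⟩ := Finset.mem_filter.1 hl
    have hsum := Submodule.finrank_sup_add_finrank_inf_eq l W
    have hlt : finrank F ↥(l ⊓ W) < finrank F l :=
      Submodule.finrank_lt_finrank_of_lt (inf_lt_left.2 hlW)
    have hle := Submodule.finrank_le (l ⊔ W)
    have h2 := hline l hl
    rw [show finrank F ↥(l ⊓ W) = 1 by lia, pow_one]
  rw [Finset.sum_congr rfl hin, Finset.sum_congr rfl hout]
  rw [← Finset.card_filter_add_card_filter_not (s := S) (fun l => l ≤ W)]
  simp only [Finset.sum_const, nsmul_eq_mul]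
  push_cast
  ring

/-- In a five-dimensional vector space over the field with `q` elements there are at most
`q ^ 3 + 1` pairwise skew lines. -/
theorem card_partial_spread_le (H : Submodule F V) (hH : finrank F H = 5)
    (S : Finset (Submodule F V)) (hline : ∀ l ∈ S, finrank F l = 2)
    (hskew : ∀ l ∈ S, ∀ l' ∈ S, l ≠ l' → l ⊓ l' = ⊥) (hSH : ∀ l ∈ S, l ≤ H)
    (hV : finrank F V = 6) :
    (#S : ℤ) ≤ (Fintype.card F : ℤ) ^ 3 + 1 := by
  by_contra! hlt
  have : Finite (Dual F V) := Module.finite_of_finite F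
  have : Fintype (Dual F V) := Fintype.ofFinite _
  have hq : (1 : ℤ) < Fintype.card F := mod_cast Fintype.one_lt_card
  have hfew : ∀ φ : Dual F V, φ ∉ H.dualAnnihilator →
      (#{l ∈ S | l ≤ LinearMap.ker φ} : ℤ) ≤ Fintype.card F := by
    intro φ hφ
    have hφ0 : φ ≠ 0 := fun h => hφ (h ▸ zero_mem _)
    have hker := φ.finrank_ker_add_one_of_ne_zero hφ0
    have hcov := card_covered_hyperplane S hline hskew (LinearMap.ker φ) hker
    have hdim : finrank F ↥(H ⊓ LinearMap.ker φ) ≤ 4 := by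
      have hnle : ¬ H ≤ LinearMap.ker φ := fun h =>
        hφ ((Submodule.mem_dualAnnihilator φ).2 fun w hw => h hw)
      have : finrank F ↥(H ⊓ LinearMap.ker φ) < finrank F H :=
        Submodule.finrank_lt_finrank_of_lt (inf_lt_left.2 hnle)
      lia
    have hsub : (Finset.univ.filter fun v : V => v ≠ 0 ∧ v ∈ LinearMap.ker φ ∧ ∃ l ∈ S, v ∈ l) ⊆
        (Finset.univ.filter fun v : V => v ∈ H ⊓ LinearMap.ker φ).erase 0 := by
      intro v hv
      obtain ⟨-, h0, hvφ, l, hl, hvl⟩ := Finset.mem_filter.1 hv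
      exact Finset.mem_erase.2 ⟨h0, Finset.mem_filter.2 ⟨Finset.mem_univ _, hSH l hl hvl, hvφ⟩⟩
    have hle := Finset.card_le_card hsub
    have hcard := (Finset.card_erase_add_one
      (Finset.mem_filter.2 ⟨Finset.mem_univ (0 : V), zero_mem (H ⊓ LinearMap.ker φ)⟩)).trans
      (card_filter_mem_submodule (H ⊓ LinearMap.ker φ))
    have hpow : Fintype.card F ^ finrank F ↥(H ⊓ LinearMap.ker φ) ≤ Fintype.card F ^ 4 :=
      Nat.pow_le_pow_right Fintype.card_pos hdim
    have hle' : (#{v : V | v ≠ 0 ∧ v ∈ LinearMap.ker φ ∧ ∃ l ∈ S, v ∈ l} : ℤ) + 1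
        ≤ (Fintype.card F : ℤ) ^ 4 := by
      exact_mod_cast (Nat.add_le_add_right hle 1).trans (hcard.le.trans hpow)
    rw [hcov] at hle'
    generalize (Fintype.card F : ℤ) = q at *
    generalize (#{l ∈ S | l ≤ LinearMap.ker φ} : ℤ) = y at *
    by_contra! hy
    have h1 : (q - 1) * (q ^ 3 + q ^ 2 + q + 2) ≤ (q - 1) * (#S + q * y) :=
      mul_le_mul_of_nonneg_left (by nlinarith) (by linarith)
    nlinarith
  have hcount := Finset.sum_card_bipartiteAbove_eq_sum_card_bipartiteBelow
    (s := (Finset.univ : Finset (Dual F V))) (t := S) (fun φ l => l ≤ LinearMap.ker φ)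
  simp only [Finset.bipartiteAbove, Finset.bipartiteBelow] at hcount
  have hann : ∀ l ∈ S, #{φ : Dual F V | l ≤ LinearMap.ker φ} = Fintype.card F ^ 4 := by
    intro l hl
    rw [← card_filter_dualAnnihilator l (r := 4) (by rw [hline l hl, hV])]
    congr 1
    ext φ
    simp [Submodule.mem_dualAnnihilator, SetLike.le_def]
  rw [Finset.sum_congr rfl hann, Finset.sum_const, smul_eq_mul,
    ← Finset.sum_filter_add_sum_filter_not _ (fun φ => φ ∈ H.dualAnnihilator)] at hcount
  have h1 := Finset.sum_le_card_nsmul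
    (Finset.univ.filter fun φ : Dual F V => φ ∈ H.dualAnnihilator)
    (fun φ => #{l ∈ S | l ≤ LinearMap.ker φ}) #S (fun φ _ => Finset.card_filter_le _ _)
  have h2 := Finset.sum_le_card_nsmul
    (Finset.univ.filter fun φ : Dual F V => φ ∉ H.dualAnnihilator)
    (fun φ => #{l ∈ S | l ≤ LinearMap.ker φ}) (Fintype.card F)
    (fun φ hφ => mod_cast hfew φ (Finset.mem_filter.1 hφ).2)
  have h3 := card_filter_dualAnnihilator H (r := 1) (by rw [hH, hV])
  have h4 := card_filter_dualAnnihilator (⊥ : Submodule F V) (r := 6) (by rw [finrank_bot, hV])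
  have h5 := Finset.card_filter_add_card_filter_not (s := (Finset.univ : Finset (Dual F V)))
    (fun φ => φ ∈ H.dualAnnihilator)
  simp only [Submodule.dualAnnihilator_bot, Submodule.mem_top, Finset.filter_true] at h4
  rw [h3, h4] at h5
  rw [h3, smul_eq_mul] at h1
  rw [smul_eq_mul] at h2
  zify at hcount h1 h2 h5
  generalize (Fintype.card F : ℤ) = q at *
  generalize (#S : ℤ) = x at *
  have h6 : x * q ^ 4 ≤ q * x + (q ^ 6 - q) * q := by
    rw [← hcount]
    refine add_le_add (by simpa using h1) (h2.trans_eq ?_)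
    rw [← h5]
    ring
  have h7 : q * (x * (q ^ 3 - 1)) ≤ q * (q * (q ^ 5 - 1)) := by linear_combination h6
  have h8 := le_of_mul_le_mul_left h7 (by linarith)
  have h9 : (q ^ 3 + 2) * (q ^ 3 - 1) ≤ x * (q ^ 3 - 1) :=
    mul_le_mul_of_nonneg_right (by linarith) (sub_nonneg.2 (one_le_pow₀ hq.le))
  nlinarith [one_lt_pow₀ hq (n := 3) (by norm_num)]

/-- Pairwise skew lines of a six-dimensional vector space that meet all lines number at least
`q ^ 3 + q ^ 2 + 1`. -/
theorem le_card_of_maximal_skew (hV : finrank F V = 6) (T : Finset (Submodule F V))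
    (hline : ∀ l ∈ T, finrank F l = 2)
    (hskew : ∀ l ∈ T, ∀ l' ∈ T, l ≠ l' → l ⊓ l' = ⊥)
    (hmax : ∀ m : Submodule F V, finrank F m = 2 → ∃ l ∈ T, m ⊓ l ≠ ⊥) :
    Fintype.card F ^ 3 + Fintype.card F ^ 2 + 1 ≤ #T := by
  have hq : (1 : ℤ) < Fintype.card F := mod_cast Fintype.one_lt_card
  by_contra! hlt
  have hk : (#T : ℤ) ≤ (Fintype.card F : ℤ) ^ 3 + (Fintype.card F : ℤ) ^ 2 := by
    exact_mod_cast Nat.lt_succ_iff.1 hlt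
  let B : Finset V := Finset.univ.filter fun v => v = 0 ∨ ∃ l ∈ T, v ∈ l
  have h0 : (0 : V) ∈ B := by simp [B]
  have hcov := card_covered_eq_sum T hskew ⊤
  have hBcard : (#B : ℤ) = 1 + #T * ((Fintype.card F : ℤ) ^ 2 - 1) := by
    have hB : B.erase 0 = Finset.univ.filter fun v : V =>
        v ≠ 0 ∧ v ∈ (⊤ : Submodule F V) ∧ ∃ l ∈ T, v ∈ l := by
      ext v
      simp only [B, Finset.mem_erase, Finset.mem_filter, Finset.mem_univ, true_and,
        Submodule.mem_top]
      tauto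
    rw [Finset.sum_congr rfl fun l hl => by rw [inf_top_eq, hline l hl], Finset.sum_const,
      nsmul_eq_mul, ← hB] at hcov
    rw [← hcov, ← Finset.card_erase_add_one h0]
    push_cast
    ring
  obtain ⟨H, hH, hHB⟩ := exists_hyperplane_subset_of_blocking 4 hV B h0
    (fun c b hb => by
      simp only [B, Finset.mem_filter, Finset.mem_univ, true_and] at hb ⊢
      rcases hb with rfl | ⟨l, hl, hbl⟩
      · exact Or.inl (smul_zero c)
      · exact Or.inr ⟨l, hl, l.smul_mem c hbl⟩)
    (fun m hm => by
      obtain ⟨l, hl, hml⟩ := hmax m hm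
      obtain ⟨v, hv, hv0⟩ := Submodule.exists_mem_ne_zero_of_ne_bot hml
      exact ⟨v, by simpa [B] using Or.inr ⟨l, hl, hv.2⟩, hv.1, hv0⟩)
    (by
      rw [hBcard]
      generalize (Fintype.card F : ℤ) = q at *
      have h1 : (#T : ℤ) * (q ^ 2 - 1) ≤ (q ^ 3 + q ^ 2) * (q ^ 2 - 1) :=
        mul_le_mul_of_nonneg_right hk (by nlinarith)
      have h2 : 1 + (#T : ℤ) * (q ^ 2 - 1) < q ^ 5 + q ^ 4 - q ^ 3 := by nlinarith
      have h3 := mul_lt_mul_of_pos_left h2 (by linarith : 0 < q)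
      linear_combination h3)
  have hcovH := card_covered_hyperplane T hline hskew H (by rw [hH, hV])
  have hfull : (Finset.univ.filter fun v : V => v ≠ 0 ∧ v ∈ H ∧ ∃ l ∈ T, v ∈ l)
      = (Finset.univ.filter fun v : V => v ∈ H).erase 0 := by
    ext v
    simp only [Finset.mem_erase, Finset.mem_filter, Finset.mem_univ, true_and]
    refine ⟨fun h => ⟨h.1, h.2.1⟩, fun ⟨hv0, hv⟩ => ⟨hv0, hv, ?_⟩⟩
    exact (Finset.mem_filter.1 (hHB v hv)).2.resolve_left hv0
  have hHcard : (#((Finset.univ.filter fun v : V => v ∈ H).erase 0) : ℤ) + 1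
      = (Fintype.card F : ℤ) ^ 5 := by
    have h := (Finset.card_erase_add_one
      (Finset.mem_filter.2 ⟨Finset.mem_univ (0 : V), zero_mem H⟩)).trans (card_filter_mem_submodule H)
    rw [hH] at h
    exact_mod_cast h
  rw [← hfull, hcovH] at hHcard
  have hx := card_partial_spread_le H hH (T.filter fun l => l ≤ H)
    (fun l hl => hline l (Finset.mem_filter.1 hl).1)
    (fun l hl l' hl' => hskew l (Finset.mem_filter.1 hl).1 l' (Finset.mem_filter.1 hl').1)
    (fun l hl => (Finset.mem_filter.1 hl).2) hV
  generalize (Fintype.card F : ℤ) = q at *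
  have h1 := mul_le_mul_of_nonneg_left hx (by linarith : 0 ≤ q)
  have h2 : (#T : ℤ) + q * #{l ∈ T | l ≤ H} ≤ q ^ 4 + q ^ 3 + q ^ 2 + q := by linarith
  have h3 := mul_le_mul_of_nonneg_left h2 (by linarith : 0 ≤ q - 1)
  nlinarith

end Spread

/-- Every maximal partial line spread of PG(5,q), q a prime power, has size at
least `q^3 + q^2 + 1`. -/
theorem stmt3 (F : Type*) [Field F] [Fintype F] (q : ℕ) (hq : Fintype.card F = q)
    (S : Set (Submodule F (Fin 6 → F))) (hS : IsMaximalPartialLineSpread F 6 S) :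
    q ^ 3 + q ^ 2 + 1 ≤ S.ncard := by
  obtain ⟨⟨hline, hskew⟩, hmax⟩ := hS
  obtain ⟨T, rfl⟩ := S.toFinite.exists_finset_coe
  rw [Set.ncard_coe_finset, ← hq]
  exact le_card_of_maximal_skew (by simp) T hline hskew hmax
end

section
/- In PG(5,q), for every prime power q ≤ 7 (i.e., q ∈ {2,3,4,5,7}) and every integer k with 1 ≤ k ≤ ⌊(4/9)q^3⌋, there exists a maximal partial line spread of size q^3 + q^2 + kq + 1. -/
/-- A quadratic extension `K = F ⊕ F ω` and a cubic extension `L = F ⊕ F α ⊕ F α²` of `F`,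
together with the linear maps that identify `K` with `F ⊕ F α` via `σ (a + b ω) = a + b α`. -/
structure ExtensionPair (F K L : Type*) [Field F] [Field K] [Field L] [Algebra F K]
    [Algebra F L] where
  /-- the generator of `K` -/
  ω : K
  /-- the coefficient of `1` -/
  re : K →ₗ[F] F
  /-- the coefficient of `ω` -/
  im : K →ₗ[F] F
  /-- the embedding `a + b ω ↦ a + b α` -/
  σ : K →ₗ[F] L
  /-- the coefficient of `α²` -/
  χ : L →ₗ[F] F
  /-- the projection `a + b α + c α² ↦ a + b ω` -/
  low : L →ₗ[F] K
  re_add_im : ∀ κ, re κ • (1 : K) + im κ • ω = κ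
  re_one : re 1 = 1
  im_one : im 1 = 0
  re_omega : re ω = 0
  im_omega : im ω = 1
  σ_one : σ 1 = 1
  low_σ : ∀ x, low (σ x) = x
  σ_low : ∀ z, σ (low z) + χ z • (σ ω * σ ω) = z
  χ_σ : ∀ x, χ (σ x) = 0
  χ_sq : χ (σ ω * σ ω) = 1

namespace ExtensionPair

section

variable {F K L : Type*} [Field F] [Field K] [Field L] [Algebra F K] [Algebra F L]
  (E : ExtensionPair F K L)

attribute [simp] re_one im_one re_omega im_omega σ_one low_σ χ_σ χ_sq

/-- The square `α²` of the generator of `L`. -/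
def e : L := E.σ E.ω * E.σ E.ω

@[simp] lemma χ_e : E.χ E.e = 1 := E.χ_sq

@[simp] lemma σ_low_add (z : L) : E.σ (E.low z) + E.χ z • E.e = z := E.σ_low z

lemma σ_injective : Function.Injective E.σ :=
  Function.LeftInverse.injective E.low_σ

@[simp] lemma σ_eq_zero {x : K} : E.σ x = 0 ↔ x = 0 :=
  map_eq_zero_iff _ E.σ_injective

lemma σ_low_of_χ_eq_zero {z : L} (hz : E.χ z = 0) : E.σ (E.low z) = z := by
  simpa [hz] using E.σ_low_add z

lemma ext_re_im {κ κ' : K} (hr : E.re κ = E.re κ') (hi : E.im κ = E.im κ') : κ = κ' := by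
  rw [← E.re_add_im κ, ← E.re_add_im κ', hr, hi]

/-- The vector `ω + t` of `K`. -/
def shift (t : F) : K := E.ω + t • (1 : K)

@[simp] lemma im_shift (t : F) : E.im (E.shift t) = 1 := by simp [shift]

@[simp] lemma re_shift (t : F) : E.re (E.shift t) = t := by simp [shift]

lemma shift_ne_zero (t : F) : E.shift t ≠ 0 := fun h => by
  simpa [h] using E.im_shift t

/-- The line of the hyperplane with slope `m`. -/
def slopeLine (m : L) : K →ₗ[F] K × L × F :=
  LinearMap.id.prod (((LinearMap.mulLeft F m).comp E.σ).prod 0)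

@[simp] lemma slopeLine_apply (m : L) (κ : K) : E.slopeLine m κ = (κ, m * E.σ κ, 0) := rfl

/-- The line at infinity of the plane `0 × L × 0`. -/
def verticalLine : K →ₗ[F] K × L × F :=
  (0 : K →ₗ[F] K).prod (E.σ.prod 0)

@[simp] lemma verticalLine_apply (κ : K) : E.verticalLine κ = (0, E.σ κ, 0) := rfl

/-- The line spanned by `(x, σ y + α², 0)` and `(ω x, σ (ω y), 1)`. -/
def transversalLine (d : K × K) : K →ₗ[F] K × L × F :=
  (LinearMap.mulRight F d.1).prod
    ((E.σ.comp (LinearMap.mulRight F d.2) + E.re.smulRight E.e).prod E.im)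

@[simp] lemma transversalLine_apply (d : K × K) (κ : K) :
    E.transversalLine d κ = (κ * d.1, E.σ (κ * d.2) + E.re κ • E.e, E.im κ) := rfl

/-- The line through `(ω + t) (x, y) + t α²` with direction `(ω + t) (1, τ)`. -/
def slicedLine (t : F) (τ x y : K) : K →ₗ[F] K × L × F :=
  ((LinearMap.mulLeft F (E.shift t)).comp
      (E.im.smulRight x + E.re.smulRight 1)).prod
    ((E.σ.comp ((LinearMap.mulLeft F (E.shift t)).comp
      (E.im.smulRight y + E.re.smulRight τ)) + (t • E.im).smulRight E.e).prod E.im)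

@[simp] lemma slicedLine_apply (t : F) (τ x y κ : K) :
    E.slicedLine t τ x y κ =
      (E.shift t * (E.im κ • x + E.re κ • 1),
        E.σ (E.shift t * (E.im κ • y + E.re κ • τ)) + (t * E.im κ) • E.e, E.im κ) := rfl

/-- The parameters of a sliced line whose point at infinity lies on the line of slope `m`, and
whose affine points avoid all transversal lines attached to slopes outside the range of `σ`. -/
structure IsSlice (m : L) (t : F) (τ x y : K) : Prop where
  slope : m * E.σ (E.shift t) = E.σ (E.shift t * τ)
  σ_mul : E.σ τ * E.σ x = E.σ y + E.e
  im_ne_zero : E.im x ≠ 0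

lemma exists_isSlice {m : L} (hm : E.χ m ≠ 0) : ∃ t τ x y, E.IsSlice m t τ x y := by
  set t : F := -(E.χ (m * E.σ E.ω) / E.χ m) with ht
  have hχ : E.χ (m * E.σ (E.shift t)) = 0 := by
    simp only [shift, map_add, map_smul, σ_one, mul_add, mul_smul_comm, mul_one, smul_eq_mul, ht]
    field_simp
    ring
  set τ : K := E.low (m * E.σ (E.shift t)) / E.shift t with hτ
  have hslope : m * E.σ (E.shift t) = E.σ (E.shift t * τ) := by
    rw [hτ, mul_div_cancel₀ _ (E.shift_ne_zero t), E.σ_low_of_χ_eq_zero hχ]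
  have him : E.im τ ≠ 0 := by
    intro h
    have h1 : τ = E.re τ • (1 : K) := by simpa [h] using (E.re_add_im τ).symm
    rw [h1, mul_smul_comm, mul_one, map_smul, ← one_mul (E.σ (E.shift t)), ← mul_assoc,
      ← smul_mul_assoc, mul_one] at hslope
    have h2 := mul_right_cancel₀ (E.σ_eq_zero.not.2 (E.shift_ne_zero t)) hslope
    rw [← E.σ_one, ← map_smul] at h2
    exact hm (by rw [h2, E.χ_σ])
  refine ⟨t, τ, (E.im τ)⁻¹ • E.ω, ((E.im τ)⁻¹ * E.re τ) • E.ω, hslope, ?_, by simpa using him⟩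
  nth_rewrite 1 [← E.re_add_im τ]
  simp only [map_add, map_smul, σ_one, e, add_mul, smul_mul_assoc, mul_smul_comm, one_mul]
  rw [smul_add, smul_smul, smul_smul, inv_mul_cancel₀ him, one_smul]

/-- The directions `(x, σ y + α²)` whose slope is infinite or lies in `M`. -/
def directions (M : Set L) : Set (K × K) :=
  {d | ∀ m ∉ M, E.σ d.2 + E.e ≠ m * E.σ d.1}

lemma χ_mul_σ {m : L} {t : F} (h : E.χ (m * E.σ (E.shift t)) = 0) (x : K) :
    E.χ (m * E.σ x) = (E.re x - E.im x * t) * E.χ m := by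
  have hx : x = (E.re x - E.im x * t) • (1 : K) + E.im x • E.shift t := by
    apply E.ext_re_im <;> simp
  nth_rewrite 1 [hx]
  simp [mul_add, h]

lemma IsSlice.χ_eq_zero {E : ExtensionPair F K L} {m : L} {t : F} {τ x y : K}
    (h : E.IsSlice m t τ x y) : E.χ (m * E.σ (E.shift t)) = 0 := by
  rw [h.slope, E.χ_σ]

lemma σ_add_e_ne_zero (y : K) : E.σ y + E.e ≠ 0 := fun h => by
  simpa using congrArg E.χ h

variable {M : Set L} {t : M → F} {τ x y : M → K}

lemma natCard_directions [Finite F] [Finite K] [Finite L] (hM : ∀ m ∈ M, E.χ m ≠ 0)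
    (hs : ∀ m : M, E.IsSlice m (t m) (τ m) (x m) (y m)) :
    Nat.card (E.directions M) = Nat.card K + Nat.card M * Nat.card F := by
  have hx (m : M) (s : F) :
      E.χ (m * E.σ ((E.χ m)⁻¹ • (1 : K) + s • E.shift (t m))) = 1 := by
    have := hM m m.2
    rw [E.χ_mul_σ (hs m).χ_eq_zero]
    simp [this]
  let X (p : M × F) : K := (E.χ p.1)⁻¹ • (1 : K) + p.2 • E.shift (t p.1)
  let f : K ⊕ (M × F) → K × K :=
    Sum.elim (fun y => (0, y)) (fun p => (X p, E.low (p.1 * E.σ (X p))))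
  have hf (p : M × F) : E.σ (E.low (p.1 * E.σ (X p))) + E.e = p.1 * E.σ (X p) := by
    have := E.σ_low_add (p.1 * E.σ (X p))
    rwa [hx, one_smul] at this
  have hX (p : M × F) : X p ≠ 0 := fun h => by
    have := hx p.1 p.2
    change E.χ (p.1 * E.σ (X p)) = 1 at this
    simp [h] at this
  have hinj : Function.Injective f := by
    rintro (y₁ | p₁) (y₂ | p₂) h
    · simpa [f] using h
    · exact absurd (congrArg Prod.fst h).symm (hX p₂)
    · exact absurd (congrArg Prod.fst h) (hX p₁)
    · obtain ⟨h₁, h₂⟩ := Prod.mk.inj h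
      have h₃ := hf p₁
      rw [h₂, hf p₂, h₁] at h₃
      have h₄ := mul_right_cancel₀ (E.σ_eq_zero.not.2 (hX p₂)) h₃
      have h₅ : p₁.1 = p₂.1 := Subtype.ext h₄.symm
      have h₆ := congrArg E.im h₁
      simp only [X, map_add, map_smul, im_one, im_shift, smul_eq_mul, mul_zero, mul_one,
        zero_add] at h₆
      rw [Prod.ext h₅ h₆]
  have hrange : Set.range f = E.directions M := by
    ext d
    constructor
    · rintro ⟨y | p, rfl⟩ m hm h
      · exact E.σ_add_e_ne_zero y (by simpa [f] using h)
      · change E.σ (E.low (p.1 * E.σ (X p))) + E.e = m * E.σ (X p) at h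
        rw [hf] at h
        have := mul_right_cancel₀ (E.σ_eq_zero.not.2 (hX p)) h
        exact hm (this ▸ p.1.2)
    · intro hd
      by_cases h0 : d.1 = 0
      · exact ⟨.inl d.2, Prod.ext h0.symm rfl⟩
      · have hσ := E.σ_eq_zero.not.2 h0
        by_cases hm : (E.σ d.2 + E.e) / E.σ d.1 ∈ M
        · set m : M := ⟨_, hm⟩
          have h₁ : (m : L) * E.σ d.1 = E.σ d.2 + E.e := div_mul_cancel₀ _ hσ
          have h₂ : (E.re d.1 - E.im d.1 * t m) * E.χ m = 1 := by
            rw [← E.χ_mul_σ (hs m).χ_eq_zero, h₁]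
            simp
          have h₃ : X (m, E.im d.1) = d.1 := by
            apply E.ext_re_im
            · simp only [X, map_add, map_smul, re_one, re_shift, smul_eq_mul, mul_one]
              rw [← eq_inv_of_mul_eq_one_left h₂]
              ring
            · simp [X]
          refine ⟨.inr (m, E.im d.1), Prod.ext h₃ ?_⟩
          change E.low (m * E.σ (X (m, E.im d.1))) = d.2
          rw [h₃]
          apply E.σ_injective
          have h₄ := hf (m, E.im d.1)
          rw [h₃] at h₄
          exact add_right_cancel (h₄.trans h₁)
        · exact absurd (div_mul_cancel₀ _ hσ).symm (hd _ hm)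
  rw [← hrange, Nat.card_range_of_injective hinj, Nat.card_sum, Nat.card_prod]

/-- The lines of the maximal partial spread attached to the set of slopes `M`. -/
def lineFamily (M : Set L) (t : M → F) (τ x y : M → K) :
    ↥Mᶜ ⊕ Unit ⊕ E.directions M ⊕ M → (K →ₗ[F] K × L × F) :=
  Sum.elim (fun m => E.slopeLine m) <| Sum.elim (fun _ => E.verticalLine) <|
    Sum.elim (fun d => E.transversalLine d)
      (fun m => E.slicedLine (t m) (τ m) (x m) (y m))

lemma eq_zero_of_re_im {κ : K} (hr : E.re κ = 0) (hi : E.im κ = 0) : κ = 0 :=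
  E.ext_re_im (by simpa using hr) (by simpa using hi)

lemma lineFamily_apply_ne_zero (i) {κ : K} (hκ : κ ≠ 0) : E.lineFamily M t τ x y i κ ≠ 0 := by
  intro h
  rcases i with m | _ | d | m
  · exact hκ (congrArg Prod.fst h)
  · have h₁ : E.σ κ = 0 := congrArg (fun v => v.2.1) h
    exact hκ (E.σ_eq_zero.1 h₁)
  · have h₁ : E.im κ = 0 := congrArg (fun v => v.2.2) h
    have h₂ : E.σ (κ * d.1.2) + E.re κ • E.e = 0 := congrArg (fun v => v.2.1) h
    exact hκ (E.eq_zero_of_re_im (by simpa using congrArg E.χ h₂) h₁)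
  · have h₁ : E.im κ = 0 := congrArg (fun v => v.2.2) h
    have h₂ : E.shift (t m) * (E.im κ • x m + E.re κ • 1) = 0 := congrArg (fun v => v.1) h
    refine hκ (E.eq_zero_of_re_im ?_ h₁)
    simpa [h₁, E.shift_ne_zero] using h₂

lemma slopeLine_ne_transversalLine {m : L} (hm : m ∉ M) {d : K × K} (hd : d ∈ E.directions M)
    {κ κ' : K} (hκ : κ ≠ 0) : E.slopeLine m κ ≠ E.transversalLine d κ' := by
  intro h
  simp only [slopeLine_apply, transversalLine_apply, Prod.mk.injEq] at h
  obtain ⟨h₁, h₂, h₃⟩ := h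
  have hκ' : κ' = E.re κ' • (1 : K) := by simpa [← h₃] using (E.re_add_im κ').symm
  have hr : E.re κ' ≠ 0 := fun h => hκ (by rw [h₁, hκ', h]; simp)
  apply hd m hm
  rw [h₁, hκ'] at h₂
  simp only [map_smul, smul_mul_assoc, one_mul, re_one, smul_eq_mul, mul_one, mul_smul_comm,
    ← smul_add] at h₂
  exact (smul_right_injective L hr h₂).symm

lemma slopeLine_ne_slicedLine {m m' : L} (hm : m ≠ m') {t : F} {τ x y : K}
    (h' : E.IsSlice m' t τ x y) {κ κ' : K} (hκ : κ ≠ 0) :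
    E.slopeLine m κ ≠ E.slicedLine t τ x y κ' := by
  intro h
  simp only [slopeLine_apply, slicedLine_apply, Prod.mk.injEq] at h
  obtain ⟨h₁, h₂, h₃⟩ := h
  rw [← h₃] at h₁ h₂
  simp only [zero_smul, zero_add, mul_zero, add_zero, mul_smul_comm, mul_one, map_smul,
    ← h'.slope] at h₁ h₂
  rw [← mul_smul_comm, ← map_smul, ← h₁] at h₂
  exact hm (mul_right_cancel₀ (E.σ_eq_zero.not.2 hκ) h₂)

lemma verticalLine_ne_transversalLine {d : K × K} {κ κ' : K} (hκ : κ' ≠ 0) :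
    E.verticalLine κ ≠ E.transversalLine d κ' := by
  intro h
  simp only [verticalLine_apply, transversalLine_apply, Prod.mk.injEq] at h
  obtain ⟨-, h₂, h₃⟩ := h
  exact hκ (E.eq_zero_of_re_im (by simpa using (congrArg E.χ h₂).symm) h₃.symm)

lemma verticalLine_ne_slicedLine {t : F} {τ x y κ κ' : K} (hκ : κ' ≠ 0) :
    E.verticalLine κ ≠ E.slicedLine t τ x y κ' := by
  intro h
  simp only [verticalLine_apply, slicedLine_apply, Prod.mk.injEq] at h
  obtain ⟨h₁, -, h₃⟩ := h
  refine hκ (E.eq_zero_of_re_im ?_ h₃.symm)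
  simpa [← h₃, E.shift_ne_zero] using h₁.symm

lemma eq_of_transversalLine_eq {d d' : K × K} {κ κ' : K} (hκ : κ ≠ 0)
    (h : E.transversalLine d κ = E.transversalLine d' κ') : d = d' := by
  simp only [transversalLine_apply, Prod.mk.injEq] at h
  obtain ⟨h₁, h₂, h₃⟩ := h
  have hr : E.re κ = E.re κ' := by simpa using congrArg E.χ h₂
  obtain rfl := E.ext_re_im hr h₃
  exact Prod.ext (mul_left_cancel₀ hκ h₁)
    (mul_left_cancel₀ hκ (E.σ_injective (add_right_cancel h₂)))

lemma IsSlice.σ_mul_combination {E : ExtensionPair F K L} {m : L} {t : F} {τ x y : K}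
    (h : E.IsSlice m t τ x y) (r s : F) :
    E.σ τ * E.σ (s • x + r • 1) = E.σ (s • y + r • τ) + s • E.e := by
  simp only [map_add, map_smul, σ_one, mul_add, mul_smul_comm, h.σ_mul, mul_one, smul_add]
  abel

lemma transversalLine_ne_slicedLine (hM : ∀ m ∈ M, E.χ m ≠ 0) {m : L} {d : K × K}
    (hd : d ∈ E.directions M)
    {t : F} {τ x y : K} (h' : E.IsSlice m t τ x y) {κ κ' : K} (hκ : κ ≠ 0) :
    E.transversalLine d κ ≠ E.slicedLine t τ x y κ' := by
  intro h
  simp only [slicedLine_apply, transversalLine_apply, Prod.mk.injEq] at h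
  obtain ⟨h₁, h₂, h₃⟩ := h
  have hr : E.re κ = t * E.im κ' := by simpa using congrArg E.χ h₂
  set s := E.im κ'
  have hκs : κ = s • E.shift t := by
    apply E.ext_re_im
    · simp [hr, mul_comm]
    · simp [h₃]
  have hs0 : s ≠ 0 := fun h0 => hκ (by rw [hκs, h0, zero_smul])
  rw [hr] at h₂
  replace h₂ := E.σ_injective (add_right_cancel h₂)
  rw [hκs, smul_mul_assoc, ← mul_smul_comm] at h₁ h₂
  replace h₁ := mul_left_cancel₀ (E.shift_ne_zero t) h₁
  replace h₂ := mul_left_cancel₀ (E.shift_ne_zero t) h₂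
  have key := h'.σ_mul_combination (E.re κ') s
  rw [← h₁, ← h₂, map_smul, map_smul, mul_smul_comm, ← smul_add] at key
  exact hd (E.σ τ) (fun hτ => hM _ hτ (E.χ_σ τ)) (smul_right_injective L hs0 key).symm

lemma eq_of_slicedLine_eq {m m' : L} {t t' : F} {τ x y τ' x' y' : K}
    (h : E.IsSlice m t τ x y) (h' : E.IsSlice m' t' τ' x' y') {κ κ' : K} (hκ : κ ≠ 0)
    (heq : E.slicedLine t τ x y κ = E.slicedLine t' τ' x' y' κ') : m = m' := by
  suffices H : t = t' ∧ τ = τ' by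
    obtain ⟨rfl, rfl⟩ := H
    exact mul_right_cancel₀ (E.σ_eq_zero.not.2 (E.shift_ne_zero t)) (h.slope.trans h'.slope.symm)
  simp only [slicedLine_apply, Prod.mk.injEq] at heq
  obtain ⟨h₁, h₂, h₃⟩ := heq
  rw [← h₃] at h₁ h₂
  have ht : t * E.im κ = t' * E.im κ := by simpa using congrArg E.χ h₂
  rw [ht] at h₂
  replace h₂ := E.σ_injective (add_right_cancel h₂)
  by_cases hs0 : E.im κ = 0
  · have hr : E.re κ ≠ 0 := fun h0 => hκ (E.eq_zero_of_re_im h0 hs0)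
    simp only [hs0, zero_smul, zero_add, mul_smul_comm, mul_one] at h₁ h₂
    have hrr : E.re κ = E.re κ' := by simpa using congrArg E.im h₁
    rw [← hrr] at h₁ h₂
    have hX := smul_right_injective K hr h₁
    have htt : t = t' := by simpa using congrArg E.re hX
    subst htt
    exact ⟨rfl, mul_left_cancel₀ (E.shift_ne_zero t) (smul_right_injective K hr h₂)⟩
  · obtain rfl := mul_right_cancel₀ hs0 ht
    replace h₁ := mul_left_cancel₀ (E.shift_ne_zero t) h₁
    replace h₂ := mul_left_cancel₀ (E.shift_ne_zero t) h₂
    have key := h.σ_mul_combination (E.re κ) (E.im κ)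
    rw [h₂, ← h'.σ_mul_combination, ← h₁] at key
    have hne : E.im κ • x + E.re κ • (1 : K) ≠ 0 := fun h0 => by
      have := congrArg E.im h0
      simp [hs0, h.im_ne_zero] at this
    exact ⟨rfl, E.σ_injective (mul_right_cancel₀ (E.σ_eq_zero.not.2 hne) key)⟩

lemma eq_of_lineFamily_eq (hM : ∀ m ∈ M, E.χ m ≠ 0)
    (hs : ∀ m : M, E.IsSlice m (t m) (τ m) (x m) (y m)) (i j)
    {κ κ' : K} (hκ : κ ≠ 0) (hκ' : κ' ≠ 0)
    (h : E.lineFamily M t τ x y i κ = E.lineFamily M t τ x y j κ') : i = j := by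
  rcases i with m | _ | d | m <;> rcases j with m' | _ | d' | m' <;>
    simp only [lineFamily, Sum.elim_inl, Sum.elim_inr] at h
  · have h₁ : κ = κ' := congrArg Prod.fst h
    have h₂ : (m : L) * E.σ κ = m' * E.σ κ' := congrArg (fun v => v.2.1) h
    rw [← h₁] at h₂
    rw [Subtype.ext (mul_right_cancel₀ (E.σ_eq_zero.not.2 hκ) h₂)]
  · exact absurd (congrArg Prod.fst h) hκ
  · exact absurd h (E.slopeLine_ne_transversalLine m.2 d'.2 hκ)
  · exact absurd h (E.slopeLine_ne_slicedLine (fun hm => m.2 (by rw [hm]; exact m'.2)) (hs m') hκ)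
  · exact absurd (congrArg Prod.fst h).symm hκ'
  · rfl
  · exact absurd h (E.verticalLine_ne_transversalLine hκ')
  · exact absurd h (E.verticalLine_ne_slicedLine hκ')
  · exact absurd h.symm (E.slopeLine_ne_transversalLine m'.2 d.2 hκ')
  · exact absurd h.symm (E.verticalLine_ne_transversalLine hκ)
  · rw [Subtype.ext (E.eq_of_transversalLine_eq hκ h)]
  · exact absurd h (E.transversalLine_ne_slicedLine hM d.2 (hs m') hκ)
  · exact absurd h.symm
      (E.slopeLine_ne_slicedLine (fun hm => m'.2 (by rw [hm]; exact m.2)) (hs m) hκ')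
  · exact absurd h.symm (E.verticalLine_ne_slicedLine hκ)
  · exact absurd h.symm (E.transversalLine_ne_slicedLine hM d'.2 (hs m) hκ')
  · rw [Subtype.ext (E.eq_of_slicedLine_eq (hs m) (hs m') hκ h)]

lemma exists_lineFamily_eq (hM : ∀ m ∈ M, E.χ m ≠ 0)
    (hs : ∀ m : M, E.IsSlice m (t m) (τ m) (x m) (y m)) (a : K) (z : L) :
    ∃ i κ, E.lineFamily M t τ x y i κ = (a, z, 0) := by
  by_cases hz : E.χ z = 0
  · by_cases ha : a = 0
    · refine ⟨.inr (.inl ()), E.low z, ?_⟩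
      simp [lineFamily, E.σ_low_of_χ_eq_zero hz, ha]
    · have hσ := E.σ_eq_zero.not.2 ha
      by_cases hm : z / E.σ a ∈ M
      · set m : M := ⟨_, hm⟩
        have h₁ : (m : L) * E.σ a = z := div_mul_cancel₀ _ hσ
        have h₂ := E.χ_mul_σ (hs m).χ_eq_zero a
        rw [h₁, hz, eq_comm, mul_eq_zero, or_iff_left (hM m m.2), sub_eq_zero] at h₂
        have h₃ : a = E.im a • E.shift (t m) := by
          apply E.ext_re_im <;> simp [h₂]
        refine ⟨.inr (.inr (.inr m)), E.im a • (1 : K), ?_⟩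
        simp only [lineFamily, Sum.elim_inr, map_smul, slicedLine_apply, im_one, re_one,
          mul_zero, mul_one, zero_smul, one_smul, zero_add, add_zero, ← (hs m).slope,
          Prod.smul_mk, smul_zero]
        rw [← mul_smul_comm, ← map_smul, ← h₃, h₁]
      · exact ⟨.inl ⟨_, hm⟩, a, by simp [lineFamily, hσ]⟩
  · set r := E.χ z with hr
    have hz' : E.σ (r⁻¹ • E.low z) + E.e = r⁻¹ • z := by
      nth_rewrite 2 [← E.σ_low_add z]
      rw [← hr, smul_add, smul_smul, inv_mul_cancel₀ hz, one_smul, map_smul]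
    by_cases hd : (r⁻¹ • a, r⁻¹ • E.low z) ∈ E.directions M
    · refine ⟨.inr (.inr (.inl ⟨_, hd⟩)), r • (1 : K), ?_⟩
      rw [map_smul]
      simp only [lineFamily, Sum.elim_inr, Sum.elim_inl, transversalLine_apply, one_mul, re_one,
        im_one, one_smul, hz', Prod.smul_mk, smul_smul, mul_inv_cancel₀ hz, smul_zero]
    · simp only [directions, Set.mem_ofPred_eq, not_forall, not_not] at hd
      obtain ⟨m, hm, h⟩ := hd
      rw [hz', map_smul, mul_smul_comm] at h
      refine ⟨.inl ⟨m, hm⟩, a, ?_⟩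
      have := smul_right_injective L (inv_ne_zero hz) h
      simp [lineFamily, ← this]

end

end ExtensionPair

/-- A family of disjoint lines that covers a hyperplane is a maximal partial line spread. -/
lemma isMaximalPartialLineSpread_range_s5 {F K I : Type*} [Field F] [AddCommGroup K] [Module F K]
    {n : ℕ} (hK : Module.finrank F K = 2) (φ : I → K →ₗ[F] (Fin n → F))
    (hne : ∀ i κ, κ ≠ 0 → φ i κ ≠ 0)
    (hdisj : ∀ i j κ κ', κ ≠ 0 → κ' ≠ 0 → φ i κ = φ j κ' → i = j)
    (h : (Fin n → F) →ₗ[F] F) (hcover : ∀ v, h v = 0 → ∃ i κ, φ i κ = v) :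
    IsMaximalPartialLineSpread F n (Set.range fun i => LinearMap.range (φ i)) ∧
      (Set.range fun i => LinearMap.range (φ i)).ncard = Nat.card I := by
  have hinj (i) : Function.Injective (φ i) :=
    (injective_iff_map_eq_zero _).2 fun κ hκ => by_contra fun h0 => hne i κ h0 hκ
  have hinf (i j) (hij : i ≠ j) : LinearMap.range (φ i) ⊓ LinearMap.range (φ j) = ⊥ := by
    rw [eq_bot_iff]
    rintro _ ⟨⟨κ, rfl⟩, ⟨κ', hκ'⟩⟩
    by_contra h0
    have h1 : κ ≠ 0 := fun e => h0 (by simp [e])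
    have h2 : κ' ≠ 0 := fun e => h0 (by rw [← hκ']; simp [e])
    exact hij (hdisj i j κ κ' h1 h2 hκ'.symm)
  refine ⟨⟨⟨?_, ?_⟩, ?_⟩, ?_⟩
  · rintro _ ⟨i, rfl⟩
    exact (LinearMap.finrank_range_of_inj (hinj i)).trans hK
  · rintro _ ⟨i, rfl⟩ _ ⟨j, rfl⟩ hij
    exact hinf i j fun e => hij (by rw [e])
  · intro m hm
    have hker : LinearMap.ker (h.comp m.subtype) ≠ ⊥ :=
      LinearMap.ker_ne_bot_of_finrank_lt (by rw [hm, Module.finrank_self]; norm_num)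
    obtain ⟨⟨v, hv⟩, hv0, hvne⟩ := Submodule.exists_mem_ne_zero_of_ne_bot hker
    obtain ⟨i, κ, rfl⟩ := hcover v hv0
    refine ⟨_, ⟨i, rfl⟩, fun hbot => hvne ?_⟩
    have : φ i κ ∈ m ⊓ LinearMap.range (φ i) := ⟨hv, κ, rfl⟩
    rw [hbot, Submodule.mem_bot] at this
    exact Subtype.ext this
  · refine Set.ncard_range_of_injective fun i j hij => by_contra fun hne' => ?_
    have hbot := hinf i j hne'
    replace hij : LinearMap.range (φ i) = LinearMap.range (φ j) := hij
    rw [← hij, inf_idem] at hbot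
    have := LinearMap.finrank_range_of_inj (hinj i)
    rw [hbot, finrank_bot, hK] at this
    exact absurd this (by norm_num)

/-- An extension pair given by power bases of degrees two and three. -/
lemma ExtensionPair.nonempty_of_basis {F K L : Type*} [Field F] [Field K] [Field L] [Algebra F K]
    [Algebra F L] {ω : K} {α : L} (b : Module.Basis (Fin 2) F K) (c : Module.Basis (Fin 3) F L)
    (hb : ∀ i, b i = ω ^ (i : ℕ)) (hc : ∀ i, c i = α ^ (i : ℕ)) :
    Nonempty (ExtensionPair F K L) := by
  have hb0 : b 0 = 1 := by simp [hb]
  have hb1 : b 1 = ω := by simp [hb]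
  have hc0 : c 0 = 1 := by simp [hc]
  have hc1 : c 1 = α := by simp [hc]
  have hc2 : c 2 = α * α := by simp [hc, pow_two]
  let σ : K →ₗ[F] L := b.constr F ![1, α]
  let low : L →ₗ[F] K := c.constr F ![1, ω, 0]
  have hσ0 : σ 1 = 1 := by rw [← hb0]; simp [σ]
  have hσ1 : σ ω = α := by rw [← hb1]; simp [σ]
  have hl0 : low 1 = 1 := by rw [← hc0]; simp [low]
  have hl1 : low α = ω := by rw [← hc1]; simp [low]
  have hl2 : low (α * α) = 0 := by rw [← hc2]; simp [low]
  have hχ0 : c.coord 2 1 = 0 := by rw [← hc0]; simp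
  have hχ1 : c.coord 2 α = 0 := by rw [← hc1]; simp
  have hχ2 : c.coord 2 (α * α) = 1 := by rw [← hc2]; simp
  have hre0 : b.coord 0 1 = 1 := by rw [← hb0]; simp
  have hre1 : b.coord 0 ω = 0 := by rw [← hb1]; simp
  have him0 : b.coord 1 1 = 0 := by rw [← hb0]; simp
  have him1 : b.coord 1 ω = 1 := by rw [← hb1]; simp
  have hlow : low.comp σ = LinearMap.id :=
    b.ext fun i => by fin_cases i <;> simp [hb0, hb1, hσ0, hσ1, hl0, hl1]
  have hχσ : (c.coord 2).comp σ = 0 := b.ext fun i => by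
    fin_cases i
    · simpa [hb0, hσ0] using hχ0
    · simpa [hb1, hσ1] using hχ1
  have hσlow : σ.comp low + (c.coord 2).smulRight (α * α) = LinearMap.id := c.ext fun i => by
    fin_cases i
    · simpa [hc0, hl0, hσ0] using Or.inl hχ0
    · simpa [hc1, hl1, hσ1] using Or.inl hχ1
    · change σ (low (c 2)) + c.coord 2 (c 2) • (α * α) = c 2
      rw [hc2, hl2, hχ2, map_zero, zero_add, one_smul]
  exact ⟨{
    ω := ω
    re := b.coord 0
    im := b.coord 1
    σ := σ
    χ := c.coord 2
    low := low
    re_add_im := fun κ => by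
      have := b.sum_repr κ
      rwa [Fin.sum_univ_two, hb0, hb1] at this
    re_one := hre0
    im_one := him0
    re_omega := hre1
    im_omega := him1
    σ_one := hσ0
    low_σ := LinearMap.congr_fun hlow
    σ_low := by rw [hσ1]; exact LinearMap.congr_fun hσlow
    χ_σ := LinearMap.congr_fun hχσ
    χ_sq := by rw [hσ1]; exact hχ2 }⟩

/-- A separable extension of degree `n` has a basis consisting of powers of one element. -/
lemma exists_basis_pow (F K : Type*) [Field F] [Field K] [Algebra F K] [FiniteDimensional F K]
    [Algebra.IsSeparable F K] {n : ℕ} (h : Module.finrank F K = n) :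
    ∃ (ω : K) (b : Module.Basis (Fin n) F K), ∀ i, b i = ω ^ (i : ℕ) := by
  let pb := Field.powerBasisOfFiniteOfSeparable F K
  have hd : pb.dim = n := pb.finrank.symm.trans h
  exact ⟨pb.gen, pb.basis.reindex (finCongr hd), fun i => by simp⟩

/-- Over every finite field `F` of order `q` and for every `k ≤ q³ - q²`, there is a maximal
partial line spread of `PG(5, q)` of size `q³ + q² + k q + 1`. -/
theorem exists_isMaximalPartialLineSpread_s5 (F : Type*) [Field F] [Finite F] {k : ℕ}
    (hk : k ≤ Nat.card F ^ 3 - Nat.card F ^ 2) :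
    ∃ S : Set (Submodule F (Fin 6 → F)), IsMaximalPartialLineSpread F 6 S ∧
      S.ncard = Nat.card F ^ 3 + Nat.card F ^ 2 + k * Nat.card F + 1 := by
  obtain ⟨p, hp⟩ := CharP.exists F
  have : Fact p.Prime := ⟨CharP.char_is_prime F p⟩
  let K := FiniteField.Extension F p 2
  let L := FiniteField.Extension F p 3
  have hK : Module.finrank F K = 2 := FiniteField.finrank_extension F p 2
  have hL : Module.finrank F L = 3 := FiniteField.finrank_extension F p 3
  have hcK : Nat.card K = Nat.card F ^ 2 := FiniteField.natCard_extension F p 2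
  have hcL : Nat.card L = Nat.card F ^ 3 := FiniteField.natCard_extension F p 3
  obtain ⟨ω, b, hb⟩ := exists_basis_pow F K hK
  obtain ⟨α, c, hc⟩ := exists_basis_pow F L hL
  obtain ⟨E⟩ := ExtensionPair.nonempty_of_basis b c hb hc
  have hker : {z : L | E.χ z = 0} = Set.range E.σ := by
    ext z
    refine ⟨fun hz => ⟨_, E.σ_low_of_χ_eq_zero hz⟩, ?_⟩
    rintro ⟨y, rfl⟩
    exact E.χ_σ y
  have hcard : {z : L | E.χ z = 0}ᶜ.ncard = Nat.card F ^ 3 - Nat.card F ^ 2 := by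
    rw [Set.ncard_compl, hcL, hker, Set.ncard_range_of_injective E.σ_injective, hcK]
  obtain ⟨M, hMsub, hMcard⟩ := Set.exists_subset_card_eq (hk.trans_eq hcard.symm)
  have hM : ∀ m ∈ M, E.χ m ≠ 0 := fun m hm => hMsub hm
  choose t τ x y hs using fun m : M => E.exists_isSlice (hM m m.2)
  have hfin : Module.finrank F (K × L × F) = Module.finrank F (Fin 6 → F) := by
    simp [hK, hL]
  let f : (K × L × F) ≃ₗ[F] (Fin 6 → F) := LinearEquiv.ofFinrankEq _ _ hfin
  obtain ⟨hmax, hsize⟩ := isMaximalPartialLineSpread_range_s5 hK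
    (fun i => f.toLinearMap.comp (E.lineFamily M t τ x y i))
    (fun i κ hκ h => E.lineFamily_apply_ne_zero i hκ (by simpa using h))
    (fun i j κ κ' hκ hκ' h => E.eq_of_lineFamily_eq hM hs i j hκ hκ' (f.injective h))
    ((LinearMap.snd F L F).comp ((LinearMap.snd F K (L × F)).comp f.symm.toLinearMap))
    (fun v hv => by
      obtain ⟨i, κ, h⟩ := E.exists_lineFamily_eq hM hs (f.symm v).1 (f.symm v).2.1
      refine ⟨i, κ, ?_⟩
      have hv' : (f.symm v).2.2 = 0 := hv
      rw [← hv'] at h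
      simp [h])
  refine ⟨_, hmax, hsize.trans ?_⟩
  rw [Nat.card_sum, Nat.card_sum, Nat.card_sum, E.natCard_directions hM hs,
    Nat.card_coe_set_eq, Nat.card_coe_set_eq, Set.ncard_compl, hMcard, hcK, hcL,
    Nat.card_unique (α := Unit)]
  have : k ≤ Nat.card F ^ 3 := hk.trans (Nat.sub_le _ _)
  omega

/-- In PG(5,q), for every prime power `q ≤ 7` (i.e. `q ∈ {2,3,4,5,7}`) and every
integer `k` with `1 ≤ k ≤ ⌊(4/9) * q^3⌋`, there is a maximal partial line
spread of size `q^3 + q^2 + k*q + 1`. -/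
theorem stmt5 (F : Type*) [Field F] [Fintype F] (q : ℕ) (hq : Fintype.card F = q)
    (hq7 : q = 2 ∨ q = 3 ∨ q = 4 ∨ q = 5 ∨ q = 7)
    (k : ℕ) (hk1 : 1 ≤ k) (hk2 : k ≤ 4 * q ^ 3 / 9) :
    ∃ S : Set (Submodule F (Fin 6 → F)),
      IsMaximalPartialLineSpread F 6 S ∧ S.ncard = q ^ 3 + q ^ 2 + k * q + 1 := by
  subst hq
  rw [← Nat.card_eq_fintype_card] at *
  refine exists_isMaximalPartialLineSpread_s5 F (hk2.trans ?_)
  rcases hq7 with h | h | h | h | h <;> rw [h] <;> norm_num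
end

section
/- In PG(5,2), the largest maximal partial line spread that is not a spread has size 19; that is, there exists a maximal partial line spread of size 19, and every maximal partial line spread of size greater than 19 has size 21 (the size of a spread), so the largest maximal partial line spread of positive deficiency has deficiency δ = 2. -/
open Module Submodule

namespace BinaryLine

variable {F : Type*} [Field F]

lemma eq_zero_or_one [Fintype F] (hq : Fintype.card F = 2) (c : F) : c = 0 ∨ c = 1 := by
  have h := FiniteField.pow_card c
  rw [hq] at h
  have h' : c * (c - 1) = 0 := by linear_combination h
  rcases mul_eq_zero.1 h' with h | h
  · exact Or.inl h
  · exact Or.inr (sub_eq_zero.1 h)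

lemma one_add_one [Fintype F] (hq : Fintype.card F = 2) : (1 + 1 : F) = 0 := by
  rcases eq_zero_or_one hq (1 + 1) with h | h
  · exact h
  · simp at h

variable {V : Type*} [AddCommGroup V] [Module F V]

lemma add_self [Fintype F] (hq : Fintype.card F = 2) (x : V) : x + x = 0 := by
  rw [← one_smul F x, ← add_smul, one_add_one hq, zero_smul]

lemma mem_span_pair_iff [Fintype F] (hq : Fintype.card F = 2) (a b x : V) :
    x ∈ span F {a, b} ↔ x = 0 ∨ x = a ∨ x = b ∨ x = a + b := by
  rw [mem_span_pair]
  constructor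
  · rintro ⟨s, t, rfl⟩
    rcases eq_zero_or_one hq s with rfl | rfl <;> rcases eq_zero_or_one hq t with rfl | rfl <;> simp
  · rintro (rfl | rfl | rfl | rfl)
    · exact ⟨0, 0, by simp⟩
    · exact ⟨1, 0, by simp⟩
    · exact ⟨0, 1, by simp⟩
    · exact ⟨1, 1, by simp⟩

lemma finrank_span_pair [Fintype F] (hq : Fintype.card F = 2) {a b : V} (ha : a ≠ 0) (hb : b ≠ 0)
    (hab : a ≠ b) : finrank F (span F {a, b}) = 2 := by
  have hli : LinearIndependent F ![a, b] := by
    rw [LinearIndependent.pair_iff' ha]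
    intro c
    rcases eq_zero_or_one hq c with rfl | rfl
    · simpa using hb.symm
    · simpa using hab
  have h := finrank_span_eq_card hli
  rwa [Matrix.range_cons_cons_empty, Fintype.card_fin] at h

lemma exists_eq_span_pair {l : Submodule F V} (hl : finrank F l = 2) :
    ∃ a b : V, a ≠ 0 ∧ b ≠ 0 ∧ a ≠ b ∧ l = span F {a, b} := by
  have : Module.Finite F l := Module.finite_of_finrank_eq_succ hl
  let B := finBasisOfFinrankEq F l hl
  refine ⟨B 0, B 1, ?_, ?_, ?_, ?_⟩
  · simpa using B.ne_zero 0
  · simpa using B.ne_zero 1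
  · intro h
    simpa using B.injective (Subtype.ext h)
  · have h := congrArg (Submodule.map l.subtype) B.span_eq
    rw [map_span, Submodule.map_top, range_subtype] at h
    refine h.symm.trans ?_
    congr 1
    ext x
    simp [Fin.exists_fin_two, eq_comm]

open Classical in
/-- The points of the projective space that lie on `l`, as nonzero vectors. -/
noncomputable def points [Fintype V] (l : Submodule F V) : Finset V :=
  {x | x ∈ l ∧ x ≠ 0}

lemma mem_points [Fintype V] {l : Submodule F V} {x : V} : x ∈ points l ↔ x ∈ l ∧ x ≠ 0 := by
  simp [points]

open Classical in
lemma points_eq [Fintype F] [Fintype V] (hq : Fintype.card F = 2) {a b : V}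
    (ha : a ≠ 0) (hb : b ≠ 0)
    (hab : a ≠ b) : points (span F {a, b}) = {a, b, a + b} := by
  have hne : a + b ≠ 0 := fun h => hab (add_right_cancel (h.trans (add_self hq b).symm))
  ext x
  simp only [mem_points, mem_span_pair_iff hq, Finset.mem_insert, Finset.mem_singleton]
  constructor
  · tauto
  · rintro (rfl | rfl | rfl) <;> simp_all

lemma card_points [Fintype F] [Fintype V] (hq : Fintype.card F = 2) {l : Submodule F V}
    (hl : finrank F l = 2) : (points l).card = 3 := by
  classical
  obtain ⟨a, b, ha, hb, hab, rfl⟩ := exists_eq_span_pair hl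
  rw [points_eq hq ha hb hab, Finset.card_eq_three]
  exact ⟨a, b, a + b, hab, by simpa using hb, by simpa using ha, rfl⟩

lemma sum_points [Fintype F] [Fintype V] (hq : Fintype.card F = 2) {l : Submodule F V}
    (hl : finrank F l = 2) : ∑ x ∈ points l, x = 0 := by
  classical
  obtain ⟨a, b, ha, hb, hab, rfl⟩ := exists_eq_span_pair hl
  rw [points_eq hq ha hb hab, Finset.sum_insert (by simp [hab, hb]),
    Finset.sum_insert (by simpa using ha), Finset.sum_singleton, ← add_assoc]
  exact add_self hq _

lemma sum_univ_eq_zero [Fintype F] (hq : Fintype.card F = 2) {n : ℕ} (hn : 2 ≤ n) :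
    ∑ x : Fin n → F, x = 0 := by
  classical
  have : Nontrivial (Fin n) := Fin.nontrivial_iff_two_le.2 hn
  ext i
  obtain ⟨j, hj⟩ := exists_ne i
  rw [Finset.sum_apply, Pi.zero_apply]
  refine Finset.sum_involution (fun x _ => x + Pi.single j 1) ?_ ?_ ?_ ?_
  · intro x _
    simpa [hj.symm] using add_self hq (x i)
  · intro x _ _
    simp
  · simp
  · intro x _
    rw [add_assoc, add_self hq, add_zero]

open Classical in
/-- A maximal partial line spread of at least `20` lines covers all `63` points: otherwise it
leaves `3` holes, whose sum is zero, and these form a line. -/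
lemma ncard_eq_of_maximal [Fintype F] (hq : Fintype.card F = 2) {S : Set (Submodule F (Fin 6 → F))}
    (hS : IsMaximalPartialLineSpread F 6 S) (h19 : 19 < S.ncard) : S.ncard = 21 := by
  obtain ⟨⟨hdim, hskew⟩, hmax⟩ := hS
  have hfin : S.Finite := Set.finite_of_ncard_pos (by omega)
  set T := hfin.toFinset with hT
  have hmemT : ∀ l, l ∈ T ↔ l ∈ S := fun l => by simp [hT]
  have hcardT : S.ncard = T.card := Set.ncard_eq_toFinset_card S hfin
  have hdisj : (T : Set (Submodule F (Fin 6 → F))).PairwiseDisjoint points := by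
    intro l hl l' hl' hne
    refine Finset.disjoint_left.2 fun x hx hx' => ?_
    rw [mem_points] at hx hx'
    have : x ∈ l ⊓ l' := ⟨hx.1, hx'.1⟩
    rw [hskew l ((hmemT l).1 hl) l' ((hmemT l').1 hl') hne, mem_bot] at this
    exact hx.2 this
  set U := T.biUnion points with hU
  have hUcard : U.card = 3 * T.card := by
    rw [hU, Finset.card_biUnion hdisj,
      Finset.sum_const_nat fun l hl => card_points hq (hdim l ((hmemT l).1 hl)), mul_comm]
  have hUsub : U ⊆ Finset.univ.erase 0 := by
    intro x hx
    obtain ⟨l, -, hx⟩ := Finset.mem_biUnion.1 hx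
    simpa using (mem_points.1 hx).2
  have hVcard : (Finset.univ.erase (0 : Fin 6 → F)).card = 63 := by
    rw [Finset.card_erase_of_mem (Finset.mem_univ _), Finset.card_univ, Fintype.card_fun, hq,
      Fintype.card_fin]
    norm_num
  have hle := Finset.card_le_card hUsub
  by_contra hne
  obtain ⟨a, b, c, hab, hac, hbc, hH⟩ := Finset.card_eq_three.1
    (show ((Finset.univ.erase 0) \ U).card = 3 by
      rw [Finset.card_sdiff_of_subset hUsub]; omega)
  have hsum : a + (b + c) = 0 := by
    have hUsum : ∑ x ∈ U, x = 0 := by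
      rw [hU, Finset.sum_biUnion hdisj]
      exact Finset.sum_eq_zero fun l hl => sum_points hq (hdim l ((hmemT l).1 hl))
    have hall : ∑ x ∈ Finset.univ.erase (0 : Fin 6 → F), x = 0 := by
      rw [Finset.sum_erase (f := fun x => x) _ rfl, sum_univ_eq_zero hq (by norm_num)]
    rw [← Finset.sum_sdiff hUsub, hUsum, add_zero, hH] at hall
    rwa [Finset.sum_insert (by simp [hab, hac]), Finset.sum_insert (by simpa using hbc),
      Finset.sum_singleton] at hall
  have hc : a + b = c := by
    rw [← add_assoc] at hsum
    exact add_right_cancel (hsum.trans (add_self hq c).symm)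
  have hhole : ∀ x, x = a ∨ x = b ∨ x = c → x ≠ 0 ∧ x ∉ U := by
    intro x hx
    have : x ∈ (Finset.univ.erase 0) \ U := by rw [hH]; simpa using hx
    simpa using this
  obtain ⟨l, hl, hml⟩ := hmax (span F {a, b})
    (finrank_span_pair hq (hhole a (by simp)).1 (hhole b (by simp)).1 hab)
  obtain ⟨x, hx, hx0⟩ := exists_mem_ne_zero_of_ne_bot hml
  have hxU : x ∈ U := Finset.mem_biUnion.2 ⟨l, (hmemT l).2 hl, mem_points.2 ⟨hx.2, hx0⟩⟩
  have hxm := (mem_span_pair_iff hq a b x).1 hx.1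
  rw [hc] at hxm
  exact (hhole x (hxm.resolve_left hx0)).2 hxU

/-- The vector over `F` whose coordinates are the binary digits of a natural number. -/
def bits (F : Type*) [Field F] (n : ℕ) : Fin 6 → F :=
  fun i => if n.testBit i then 1 else 0

@[simp] lemma bits_zero : bits F 0 = 0 := by
  ext i
  simp [bits]

lemma bits_xor [Fintype F] (hq : Fintype.card F = 2) (m n : ℕ) :
    bits F (m ^^^ n) = bits F m + bits F n := by
  ext i
  simp only [bits, Nat.testBit_xor, Pi.add_apply]
  cases m.testBit i <;> cases n.testBit i <;> simp [one_add_one hq]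

lemma bits_injOn {m n : ℕ} (hm : m < 64) (hn : n < 64) (h : bits F m = bits F n) : m = n := by
  refine Nat.eq_of_testBit_eq fun i => ?_
  rcases lt_or_ge i 6 with hi | hi
  · have := congrFun h ⟨i, hi⟩
    simp only [bits] at this
    cases h₁ : m.testBit i <;> cases h₂ : n.testBit i <;> simp_all
  · have hpow : 64 ≤ 2 ^ i := Nat.pow_le_pow_right (n := 2) (by norm_num) hi
    rw [Nat.testBit_lt_two_pow (hm.trans_le hpow), Nat.testBit_lt_two_pow (hn.trans_le hpow)]

lemma exists_bits_eq [Fintype F] (hq : Fintype.card F = 2) (x : Fin 6 → F) :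
    ∃ n < 64, bits F n = x := by
  have hinj : Function.Injective fun n : Fin 64 => bits F n :=
    fun m n h => Fin.ext (bits_injOn m.2 n.2 h)
  have hbij := (Fintype.bijective_iff_injective_and_card _).2 ⟨hinj, by simp [hq]⟩
  obtain ⟨n, hn⟩ := hbij.2 x
  exact ⟨n, n.2, hn⟩

/-- Two points on each of `19` pairwise skew lines of PG(5,2), in binary. The points on none of
these lines are `1, 2, 4, 8, 16, 31`, no three of which are collinear. -/
def generators : Fin 19 → ℕ × ℕ :=
  ![(3, 32), (5, 11), (6, 42), (7, 41), (9, 23), (10, 48), (12, 51), (13, 22), (15, 50), (17, 36),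
    (18, 37), (19, 39), (20, 40), (21, 43), (24, 33), (25, 47), (26, 34), (28, 45), (29, 38)]

/-- The nonzero vectors on the `i`-th line, in binary. -/
def pointCodes (i : Fin 19) : List ℕ :=
  [(generators i).1, (generators i).2, (generators i).1 ^^^ (generators i).2]

lemma pointCodes_bounds : ∀ i, ∀ n ∈ pointCodes i, 0 < n ∧ n < 64 := by decide +kernel

lemma generators_ne : ∀ i, (generators i).1 ≠ (generators i).2 := by decide +kernel

lemma pointCodes_disjoint : ∀ i j, i ≠ j → ∀ n ∈ pointCodes i, n ∉ pointCodes j := by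
  decide +kernel

lemma exists_mem_pointCodes : ∀ m < 64, ∀ n < 64, m ≠ 0 → n ≠ 0 → m ≠ n →
    ∃ i, m ∈ pointCodes i ∨ n ∈ pointCodes i ∨ m ^^^ n ∈ pointCodes i := by
  have h : ∀ m n : Fin 64, m.val ≠ 0 → n.val ≠ 0 → m.val ≠ n.val →
      ∃ i, m.val ∈ pointCodes i ∨ n.val ∈ pointCodes i ∨ m.val ^^^ n.val ∈ pointCodes i := by
    decide +kernel
  exact fun m hm n hn => h ⟨m, hm⟩ ⟨n, hn⟩

/-- The lines of a maximal partial line spread of deficiency `2`. -/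
def line (F : Type*) [Field F] (i : Fin 19) : Submodule F (Fin 6 → F) :=
  span F {bits F (generators i).1, bits F (generators i).2}

lemma bits_ne_zero {n : ℕ} (h0 : 0 < n) (h : n < 64) : bits F n ≠ 0 := fun he =>
  h0.ne' (bits_injOn (F := F) h (by norm_num) (by simpa using he))

lemma mem_line [Fintype F] (hq : Fintype.card F = 2) {i : Fin 19} {x : Fin 6 → F} :
    x ∈ line F i ↔ x = 0 ∨ ∃ n ∈ pointCodes i, bits F n = x := by
  simp [line, mem_span_pair_iff hq, pointCodes, bits_xor hq, eq_comm]

lemma finrank_line [Fintype F] (hq : Fintype.card F = 2) (i : Fin 19) : finrank F (line F i) = 2 := by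
  obtain ⟨h₁, h₁'⟩ := pointCodes_bounds i (generators i).1 (by simp [pointCodes])
  obtain ⟨h₂, h₂'⟩ := pointCodes_bounds i (generators i).2 (by simp [pointCodes])
  exact finrank_span_pair hq (bits_ne_zero h₁ h₁') (bits_ne_zero h₂ h₂')
    fun h => generators_ne i (bits_injOn h₁' h₂' h)

lemma line_inf_line [Fintype F] (hq : Fintype.card F = 2) {i j : Fin 19} (hij : i ≠ j) :
    line F i ⊓ line F j = ⊥ := by
  rw [eq_bot_iff]
  rintro x ⟨hi, hj⟩
  rcases (mem_line hq).1 hi with rfl | ⟨m, hm, rfl⟩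
  · simp
  rcases (mem_line hq).1 hj with h | ⟨n, hn, h⟩
  · simp [h]
  · have := bits_injOn (pointCodes_bounds j n hn).2 (pointCodes_bounds i m hm).2 h
    exact absurd (this ▸ hn) (pointCodes_disjoint i j hij m hm)

lemma line_injective [Fintype F] (hq : Fintype.card F = 2) : Function.Injective (line F) := by
  intro i j h
  by_contra hij
  have hbot := line_inf_line hq hij
  rw [← h, inf_idem] at hbot
  have hrank := finrank_line hq i
  rw [hbot, finrank_bot] at hrank
  omega

lemma isMaximalPartialLineSpread_range_line [Fintype F] (hq : Fintype.card F = 2) :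
    IsMaximalPartialLineSpread F 6 (Set.range (line F)) := by
  refine ⟨⟨?_, ?_⟩, ?_⟩
  · rintro _ ⟨i, rfl⟩
    exact finrank_line hq i
  · rintro _ ⟨i, rfl⟩ _ ⟨j, rfl⟩ hne
    exact line_inf_line hq fun h => hne (h ▸ rfl)
  · intro l hl
    obtain ⟨a, b, ha, hb, hab, rfl⟩ := exists_eq_span_pair hl
    obtain ⟨m, hm, rfl⟩ := exists_bits_eq hq a
    obtain ⟨n, hn, rfl⟩ := exists_bits_eq hq b
    obtain ⟨i, hi⟩ := exists_mem_pointCodes m hm n hn (by rintro rfl; simp at ha)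
      (by rintro rfl; simp at hb) (by rintro rfl; exact hab rfl)
    refine ⟨_, ⟨i, rfl⟩, ?_⟩
    have key : ∀ k ∈ pointCodes i, bits F k ∈ span F {bits F m, bits F n} →
        span F {bits F m, bits F n} ⊓ line F i ≠ ⊥ := fun k hk hmem =>
      (Submodule.ne_bot_iff _).2 ⟨bits F k, ⟨hmem, (mem_line hq).2 (Or.inr ⟨k, hk, rfl⟩)⟩,
        bits_ne_zero (pointCodes_bounds i k hk).1 (pointCodes_bounds i k hk).2⟩
    rcases hi with hi | hi | hi <;> refine key _ hi ?_ <;>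
      simp [mem_span_pair_iff hq, bits_xor hq]

end BinaryLine

/-- In PG(5,2), the largest maximal partial line spread that is not a spread
has size 19: there is a maximal partial line spread of size 19, and every
maximal partial line spread of size greater than 19 has size 21 (a spread). -/
theorem stmt6 (F : Type*) [Field F] [Fintype F] (hq : Fintype.card F = 2) :
    (∃ S : Set (Submodule F (Fin 6 → F)),
      IsMaximalPartialLineSpread F 6 S ∧ S.ncard = 19) ∧
    (∀ S : Set (Submodule F (Fin 6 → F)),
      IsMaximalPartialLineSpread F 6 S → 19 < S.ncard → S.ncard = 21) := by
  refine ⟨⟨Set.range (BinaryLine.line F),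
    BinaryLine.isMaximalPartialLineSpread_range_line hq, ?_⟩,
    fun S hS h => BinaryLine.ncard_eq_of_maximal hq hS h⟩
  rw [← Set.image_univ, Set.ncard_image_of_injective _ (BinaryLine.line_injective hq),
    Set.ncard_univ, Nat.card_eq_fintype_card, Fintype.card_fin]
end
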